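/- Let b̄ := ∑_{α=1}^{𝚖} ∫_{𝕋^d} b(x,α) m(x,α) dx ∈ ℝ^d be the average of the drift with respect to the invariant density. Then for each k ∈ {1,…,d} there exists a unique function Φ_k : ℝ^d × 𝕀 → ℝ with Φ_k(·,α) ∈ C² for every α ∈ 𝕀, solving the cell problem: ℒΦ_k(x,α) = b_k(x,α) − b̄_k for all (x,α) ∈ ℝ^d × 𝕀, Φ_k is 1-periodic in x, and ∑_{α=1}^{𝚖} ∫_{𝕋^d} Φ_k(x,α) dx = 0. -/

import Mathlib

open MeasureTheory Matrix Finset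

noncomputable section

/-- Partial derivative `∂f/∂x_j` of a function on `ℝ^d`. -/
def pd {d : ℕ} (f : (Fin d → ℝ) → ℝ) (j : Fin d) (x : Fin d → ℝ) : ℝ :=
  fderiv ℝ f x (Pi.single j 1)

/-- Second partial derivative `∂²f/∂x_j∂x_k`. -/
def pd2 {d : ℕ} (f : (Fin d → ℝ) → ℝ) (j k : Fin d) (x : Fin d → ℝ) : ℝ :=
  pd (fun y => pd f j y) k x

/-- `1`-periodicity of a function on `ℝ^d`. -/
def Per {d : ℕ} (f : (Fin d → ℝ) → ℝ) : Prop :=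
  ∀ (x : Fin d → ℝ) (ν : Fin d → ℤ), f (x + fun i => (ν i : ℝ)) = f x

/-- Integral over the fundamental domain `[0,1)^d` of the torus `𝕋^d`. -/
def tInt {d : ℕ} (f : (Fin d → ℝ) → ℝ) : ℝ :=
  ∫ x in Set.pi Set.univ (fun _ : Fin d => Set.Ico (0:ℝ) 1), f x

/-- Diffusion matrix `a(x,α) = σ(x,α) σ(x,α)ᵀ`. -/
def diffMat {d r m : ℕ} (σ : (Fin d → ℝ) → Fin m → Matrix (Fin d) (Fin r) ℝ)
    (x : Fin d → ℝ) (α : Fin m) : Matrix (Fin d) (Fin d) ℝ :=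
  σ x α * (σ x α)ᵀ

/-- The jump part `Qf(x,α) = ∑_{β ≠ α} q_{αβ}(x) [f(x,β) - f(x,α)]` of the generator. -/
def jumpOp {d m : ℕ} (q : Fin m → Fin m → (Fin d → ℝ) → ℝ)
    (f : (Fin d → ℝ) → Fin m → ℝ) (x : Fin d → ℝ) (α : Fin m) : ℝ :=
  ∑ β ∈ Finset.univ.filter (fun β => β ≠ α), q α β x * (f x β - f x α)

/-- The generator `ℒ` of the switching diffusion. -/
def gen {d m : ℕ} (b : (Fin d → ℝ) → Fin m → Fin d → ℝ)
    (a : (Fin d → ℝ) → Fin m → Matrix (Fin d) (Fin d) ℝ)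
    (q : Fin m → Fin m → (Fin d → ℝ) → ℝ)
    (f : (Fin d → ℝ) → Fin m → ℝ) (x : Fin d → ℝ) (α : Fin m) : ℝ :=
  (∑ j, b x α j * pd (fun y => f y α) j x)
    + (1/2) * ∑ j, ∑ k, a x α j k * pd2 (fun y => f y α) j k x
    + jumpOp q f x α

/-- The formal `L²`-adjoint `ℒ*`; its jump part uses the transposed intensity matrix and
includes the diagonal term. -/
def genAdj {d m : ℕ} (b : (Fin d → ℝ) → Fin m → Fin d → ℝ)
    (a : (Fin d → ℝ) → Fin m → Matrix (Fin d) (Fin d) ℝ)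
    (q : Fin m → Fin m → (Fin d → ℝ) → ℝ)
    (g : (Fin d → ℝ) → Fin m → ℝ) (x : Fin d → ℝ) (α : Fin m) : ℝ :=
  -(∑ j, pd (fun y => b y α j * g y α) j x)
    + (1/2) * ∑ j, ∑ k, pd2 (fun y => a y α j k * g y α) j k x
    + ∑ β, q β α x * g x β


/-- Hilbert space of square summable families. -/
abbrev HS (J : Type*) := lp (fun _ : J => ℂ) 2

lemma memlp_weighted {J : Type*} (φ : J → ℂ) (C : ℝ) (hφ : ∀ j, ‖φ j‖ ≤ C)
    (τ : J → J) (hτ : Function.Injective τ) (w : HS J) :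
    Memℓp (fun j => φ j * w (τ j)) 2 := by
  have h1 : Summable fun j => ‖w j‖ ^ (2:ℝ) := by
    have := (lp.memℓp w).summable (by norm_num)
    simpa using this
  refine memℓp_gen ?_
  simp only [ENNReal.toReal_ofNat]
  refine Summable.of_nonneg_of_le (fun j => by positivity) (fun j => ?_)
    ((h1.comp_injective hτ).mul_left (C ^ (2:ℝ)))
  simp only [Function.comp]
  rw [norm_mul, Real.mul_rpow (norm_nonneg _) (norm_nonneg _)]
  gcongr
  exact hφ j

/-- Weighted composition operator. -/
lemma weighted_exists {J : Type*} (φ : J → ℂ) (C : ℝ) (hφ : ∀ j, ‖φ j‖ ≤ C) (hC : 0 ≤ C)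
    (τ : J → J) (hτ : Function.Injective τ) :
    ∃ T : HS J →L[ℂ] HS J, (∀ w j, T w j = φ j * w (τ j)) ∧ ‖T‖ ≤ C := by
  let L : HS J →ₗ[ℂ] HS J :=
    { toFun := fun w => ⟨fun j => φ j * w (τ j), memlp_weighted φ C hφ τ hτ w⟩
      map_add' := by
        intro x y
        ext j
        simp [mul_add]
        rfl
      map_smul' := by
        intro c x
        ext j
        simp
        ring }
  have hb : ∀ w, ‖L w‖ ≤ C * ‖w‖ := by
    intro w
    have h2 : (0:ℝ) < (2 : ENNReal).toReal := by norm_num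
    refine lp.norm_le_of_forall_sum_le h2 (by positivity) (fun s => ?_)
    simp only [ENNReal.toReal_ofNat]
    calc ∑ i ∈ s, ‖L w i‖ ^ (2:ℝ) ≤ ∑ i ∈ s, C ^ (2:ℝ) * ‖w (τ i)‖ ^ (2:ℝ) := by
          refine Finset.sum_le_sum fun j _ => ?_
          change ‖φ j * w (τ j)‖ ^ (2:ℝ) ≤ _
          rw [norm_mul, Real.mul_rpow (norm_nonneg _) (norm_nonneg _)]
          gcongr
          exact hφ j
      _ = C ^ (2:ℝ) * ∑ i ∈ s.map ⟨τ, hτ⟩, ‖w i‖ ^ (2:ℝ) := by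
          rw [Finset.sum_map, Finset.mul_sum]; rfl
      _ ≤ C ^ (2:ℝ) * ‖w‖ ^ (2:ℝ) := by
          gcongr
          have := lp.sum_rpow_le_norm_rpow h2 w (s.map ⟨τ, hτ⟩)
          simpa using this
      _ = (C * ‖w‖) ^ (2:ℝ) := by rw [Real.mul_rpow hC (norm_nonneg _)]
  exact ⟨L.mkContinuous C hb, fun w j => rfl, L.mkContinuous_norm_le hC hb⟩

/-- coordinate evaluation is continuous -/
lemma coord_exists {J : Type*} (j : J) : ∃ E : HS J →L[ℂ] ℂ, ∀ w, E w = w j := by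
  let L : HS J →ₗ[ℂ] ℂ :=
    { toFun := fun w => w j
      map_add' := fun x y => by simp
      map_smul' := fun c x => by simp }
  exact ⟨L.mkContinuous 1 (fun w => by
    rw [one_mul]; exact lp.norm_apply_le_norm (by norm_num) w j), fun w => rfl⟩

lemma op_exists {J : Type*} [AddCommGroup J] (K : J → J → ℂ) (G : J → ℝ) (hG : Summable G)
    (hK : ∀ j i, ‖K j i‖ ≤ G (j - i)) :
    ∃ T : HS J →L[ℂ] HS J, ∀ w j, HasSum (fun i => K j i * w i) (T w j) := by
  have hG0 : ∀ g, 0 ≤ G g := fun g => by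
    have := hK g 0
    rw [sub_zero] at this
    exact (norm_nonneg _).trans this
  have hex : ∀ g : J, ∃ T : HS J →L[ℂ] HS J,
      (∀ w j, T w j = K j (j - g) * w (j - g)) ∧ ‖T‖ ≤ G g := fun g =>
    weighted_exists (fun j => K j (j - g)) (G g)
      (fun j => by simpa using hK j (j - g)) (hG0 g) (fun j => j - g)
      (fun a b h => by simpa using h)
  choose T hT hTn using hex
  have hs : Summable T := Summable.of_norm_bounded hG hTn
  refine ⟨∑' g, T g, fun w j => ?_⟩
  obtain ⟨E, hE⟩ := coord_exists (J := J) j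
  have h1 : HasSum T (∑' g, T g) := hs.hasSum
  have h2 : HasSum (fun g => (T g) w) ((∑' g, T g) w) :=
    ((ContinuousLinearMap.apply ℂ (HS J) w).hasSum h1)
  have h3 : HasSum (fun g => E ((T g) w)) (E ((∑' g, T g) w)) := E.hasSum h2
  simp only [hE, hT] at h3
  have h4 := (Equiv.subLeft j).hasSum_iff.mpr h3
  refine h4.congr_fun ?_ |> fun h => h
  intro i
  simp

lemma diag_compact {J : Type*} (φ : J → ℂ) (hφ : Filter.Tendsto φ Filter.cofinite (nhds 0)) :
    ∃ D : HS J →L[ℂ] HS J, IsCompactOperator D ∧ ∀ w j, D w j = φ j * w j := by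
  classical
  have hfin : ∀ ε : ℝ, 0 < ε → {j | ε ≤ ‖φ j‖}.Finite := by
    intro ε hε
    have := hφ (Metric.ball_mem_nhds 0 hε)
    rw [Filter.mem_map, Filter.mem_cofinite] at this
    refine this.subset (fun j hj => ?_)
    simpa using hj
  obtain ⟨C, hC0, hC⟩ : ∃ C, 0 ≤ C ∧ ∀ j, ‖φ j‖ ≤ C := by
    obtain ⟨C, hC⟩ := ((hfin 1 one_pos).image (fun j => ‖φ j‖)).bddAbove
    refine ⟨max 1 C, by positivity, fun j => ?_⟩
    by_cases h : 1 ≤ ‖φ j‖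
    · exact le_max_of_le_right (hC ⟨j, h, rfl⟩)
    · exact le_max_of_le_left (not_le.mp h).le
  obtain ⟨D, hD, -⟩ := weighted_exists φ C hC hC0 id Function.injective_id
  refine ⟨D, ?_, hD⟩
  -- finite truncations
  have htr : ∀ n : ℕ, ∃ Dn : HS J →L[ℂ] HS J, IsCompactOperator Dn ∧ ‖Dn - D‖ ≤ 1 / (n + 1 : ℝ) := by
    intro n
    have hε : (0:ℝ) < 1 / (n + 1 : ℝ) := by positivity
    set F : Finset J := (hfin _ hε).toFinset with hF
    choose E hE using fun j : J => coord_exists (J := J) j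
    let P : HS J →L[ℂ] (F → ℂ) := ContinuousLinearMap.pi (fun j => φ j • E j)
    let Q : (F → ℂ) →ₗ[ℂ] HS J :=
      ∑ j : F, (lp.lsingle (𝕜 := ℂ) (E := fun _ : J => ℂ) 2 (j : J)).comp (LinearMap.proj j)
    let Q' : (F → ℂ) →L[ℂ] HS J := LinearMap.toContinuousLinearMap Q
    refine ⟨Q'.comp P, ?_, ?_⟩
    · have hid : IsCompactOperator (id : (F → ℂ) → (F → ℂ)) := isCompactOperator_id_iff_locallyCompactSpace.2 inferInstance
      have := (hid.comp_clm P).clm_comp Q'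
      exact this
    · have hv : ∀ w j, (Q'.comp P) w j = if j ∈ F then φ j * w j else 0 := by
        intro w j
        have : (Q'.comp P) w = ∑ i : F, lp.single 2 (i : J) (φ i * w i) := by
          simp [Q', Q, P, hE]
        rw [this, lp.coeFn_sum, Finset.sum_apply]
        simp only [lp.coeFn_single, Pi.single_apply]
        by_cases hj : j ∈ F
        · rw [if_pos hj, Finset.sum_eq_single (⟨j, hj⟩ : F)]
          · simp
          · intro b _ hb
            rw [if_neg]
            rintro rfl
            exact hb rfl
          · simp
        · rw [if_neg hj]
          refine Finset.sum_eq_zero fun i _ => ?_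
          rw [if_neg]
          rintro rfl
          exact hj i.2
      obtain ⟨T, hT, hTn⟩ := weighted_exists (fun j => if j ∈ F then 0 else - φ j)
        (1 / (n + 1 : ℝ)) (fun j => by
          by_cases hj : j ∈ F
          · simp only [hj, if_true, norm_zero]; exact hε.le
          · simp only [hj, if_false, norm_neg]
            rw [hF, Set.Finite.mem_toFinset, Set.mem_ofPred_eq, not_le] at hj
            exact hj.le) hε.le id Function.injective_id
      have : Q'.comp P - D = T := by
        ext w j
        rw [_root_.sub_apply, lp.coeFn_sub, Pi.sub_apply, hv, hD, hT]
        by_cases hj : j ∈ F <;> simp [hj]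
      rw [this]
      exact hTn
  choose Dn hDc hDn using htr
  have hlim : Filter.Tendsto Dn Filter.atTop (nhds D) := by
    rw [tendsto_iff_norm_sub_tendsto_zero]
    exact squeeze_zero (fun _ => norm_nonneg _) hDn tendsto_one_div_add_atTop_nhds_zero_nat
  exact isCompactOperator_of_tendsto hlim (Filter.Eventually.of_forall hDc)

lemma abstract_solve {J : Type*} [AddCommGroup J] (KA KC KC' : J → J → ℂ) (G : J → ℝ)
    (hG : Summable G) (φ : J → ℂ) (hφ : Filter.Tendsto φ Filter.cofinite (nhds 0))
    (hA : ∀ j i, ‖KA j i‖ ≤ G (j - i)) (hC : ∀ j i, ‖KC' j i‖ ≤ G (j - i))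
    (hCC : ∀ j i, KC j i = KC' j i * φ i)
    (c : ℝ) (hc : 0 < c)
    (hcoer : ∀ (F : Finset J) (w : J → ℂ), c * ∑ j ∈ F, ‖w j‖ ^ 2 ≤
      (∑ j ∈ F, ∑ i ∈ F, (starRingEnd ℂ) (w j) * (KA j i * w i)).re)
    (hinj : ∀ w : HS J, (∀ j, HasSum (fun i => (KA j i + KC j i) * w i) 0) → w = 0) (f : HS J) :
    ∃ w : HS J, ∀ j, HasSum (fun i => (KA j i + KC j i) * w i) (f j) := by
  classical
  obtain ⟨A, hAs⟩ := op_exists KA G hG hA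
  obtain ⟨C', hCs⟩ := op_exists KC' G hG hC
  obtain ⟨D, hDc, hD⟩ := diag_compact φ hφ
  have hsum : ∀ w j, HasSum (fun i => (KA j i + KC j i) * w i) ((A w + C' (D w)) j) := by
    intro w j
    have := (hAs w j).add (hCs (D w) j)
    rw [lp.coeFn_add, Pi.add_apply]
    refine this.congr_fun ?_ |> fun h => h
    intro i
    simp only [hD, hCC]
    ring
  -- coercivity
  have hco1 : ∀ (w : HS J), c * ‖w‖ ^ 2 ≤ (inner ℂ w (A w)).re := by
    intro w
    have hs := lp.hasSum_single (p := 2) (by norm_num) w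
    have hl : Filter.Tendsto (fun F : Finset J => ∑ i ∈ F, lp.single 2 i (w i)) Filter.atTop (nhds w) := hs
    have hcont : Continuous fun v : HS J => (inner ℂ v (A v)).re - c * ‖v‖ ^ 2 := by fun_prop
    have h0 := (hcont.tendsto w).comp hl
    have : 0 ≤ (inner ℂ w (A w)).re - c * ‖w‖ ^ 2 := by
      refine ge_of_tendsto' h0 (fun F => ?_)
      simp only [Function.comp]
      set v : HS J := ∑ i ∈ F, lp.single 2 i (w i) with hv
      have hvj : ∀ j, v j = if j ∈ F then w j else 0 := by
        intro j
        rw [hv, lp.coeFn_sum, Finset.sum_apply]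
        simp only [lp.coeFn_single, Pi.single_apply]
        rw [Finset.sum_ite_eq]
      have h1 : ‖v‖ ^ 2 = ∑ j ∈ F, ‖w j‖ ^ 2 := by
        have h2 : (0:ℝ) < (2 : ENNReal).toReal := by norm_num
        have := lp.norm_rpow_eq_tsum h2 v
        simp only [ENNReal.toReal_ofNat] at this
        norm_cast at this
        rw [this, tsum_eq_sum (s := F)]
        · refine Finset.sum_congr rfl fun j hj => by rw [hvj, if_pos hj]
        · intro j hj
          rw [hvj, if_neg hj]; simp
      have h3 : ∀ j, A v j = ∑ i ∈ F, KA j i * w i := by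
        intro j
        have := hAs v j
        refine this.unique ?_
        have h4 : HasSum (fun i => KA j i * v i) (∑ i ∈ F, KA j i * v i) := by
          refine hasSum_sum_of_ne_finset_zero ?_
          intro i hi
          rw [hvj, if_neg hi, mul_zero]
        have h5 : ∑ i ∈ F, KA j i * v i = ∑ i ∈ F, KA j i * w i :=
          Finset.sum_congr rfl fun i hi => by rw [hvj, if_pos hi]
        rwa [h5] at h4
      have h6 : inner ℂ v (A v) = ∑ j ∈ F, ∑ i ∈ F, (starRingEnd ℂ) (w j) * (KA j i * w i) := by
        rw [lp.inner_eq_tsum, tsum_eq_sum (s := F)]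
        · refine Finset.sum_congr rfl fun j hj => ?_
          rw [h3, hvj, if_pos hj, ← Finset.mul_sum]
          simp [mul_comm]
        · intro j hj
          rw [hvj, if_neg hj]; simp
      rw [h6, h1]
      linarith [hcoer F w]
    linarith
  have hunit : IsUnit A := by
    refine ContinuousLinearMap.isUnit_of_forall_le_norm_inner_map A (c := ⟨c, hc.le⟩) hc (fun x => ?_)
    have h1 := hco1 x
    have h2 : (inner ℂ x (A x)).re ≤ ‖inner ℂ x (A x)‖ := Complex.re_le_norm _
    rw [norm_inner_symm]
    change ‖x‖ ^ 2 * c ≤ _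
    linarith
  obtain ⟨u, hu⟩ := hunit
  have hA1 : ∀ x, A ((↑u⁻¹ : HS J →L[ℂ] HS J) x) = x := by
    intro x
    have : (u : HS J →L[ℂ] HS J) * (↑u⁻¹ : HS J →L[ℂ] HS J) = 1 := u.mul_inv
    rw [← hu]
    exact congrArg (fun T : HS J →L[ℂ] HS J => T x) this
  set B : HS J →L[ℂ] HS J := (↑u⁻¹ : HS J →L[ℂ] HS J) with hB
  let T : HS J →L[ℂ] HS J := B.comp (C'.comp D)
  have hT : IsCompactOperator T := by
    have := hDc.clm_comp (B.comp C')
    exact this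
  rcases hT.hasEigenvalue_or_mem_resolventSet (μ := (-1 : ℂ)) (by norm_num) with h | h
  · exfalso
    obtain ⟨v, hv⟩ := h.exists_hasEigenvector
    have hv1 : T v = (-1 : ℂ) • v := hv.apply_eq_smul
    have h2 : A v + C' (D v) = 0 := by
      have := congrArg A hv1
      simp only [T, ContinuousLinearMap.comp_apply, hA1, map_smul] at this
      rw [this]; simp
    refine hv.2 (hinj v (fun j => ?_))
    have := hsum v j
    rw [h2] at this
    simpa using this
  · rw [spectrum.mem_resolventSet_iff] at h
    obtain ⟨S, hS⟩ := h
    set z := (↑S⁻¹ : HS J →L[ℂ] HS J) (B f) with hz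
    have h3 : (algebraMap ℂ (HS J →L[ℂ] HS J) (-1) - T) z = B f := by
      have : (S : HS J →L[ℂ] HS J) * (↑S⁻¹ : HS J →L[ℂ] HS J) = 1 := S.mul_inv
      rw [← hS]
      exact congrArg (fun T : HS J →L[ℂ] HS J => T (B f)) this
    refine ⟨-z, fun j => ?_⟩
    have h4 : A (-z) + C' (D (-z)) = f := by
      have := congrArg A h3
      rw [_root_.sub_apply, map_sub, hA1] at this
      simp only [T, ContinuousLinearMap.comp_apply, hA1] at this
      rw [← this]
      simp [Algebra.algebraMap_eq_smul_one]
      abel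
    have := hsum (-z) j
    rwa [h4] at this



/-- the fundamental cube -/
def cube (d : ℕ) : Set (Fin d → ℝ) := Set.pi Set.univ (fun _ : Fin d => Set.Ico (0:ℝ) 1)

/-- periodicity with general codomain -/
def PerE {d : ℕ} {E : Type*} (f : (Fin d → ℝ) → E) : Prop :=
  ∀ (x : Fin d → ℝ) (ν : Fin d → ℤ), f (x + fun i => (ν i : ℝ)) = f x

lemma cube_ae (d : ℕ) : cube d =ᵐ[volume] Set.Icc (0 : Fin d → ℝ) 1 := by
  have := Measure.univ_pi_Ico_ae_eq_Icc (μ := fun _ : Fin d => (volume : Measure ℝ))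
    (f := (0 : Fin d → ℝ)) (g := (1 : Fin d → ℝ))
  exact this

lemma cube_subset (d : ℕ) : cube d ⊆ Set.Icc (0 : Fin d → ℝ) 1 := by
  intro x hx
  exact ⟨fun i => (hx i trivial).1, fun i => (hx i trivial).2.le⟩

lemma cube_vol (d : ℕ) : volume.real (cube d) = 1 := by
  unfold cube
  rw [measureReal_def, Real.volume_pi_Ico_toReal]
  · simp
  · intro i; simp

lemma cube_integrable {d : ℕ} {E : Type*} [NormedAddCommGroup E] {f : (Fin d → ℝ) → E}
    (hf : Continuous f) : Integrable f (volume.restrict (cube d)) :=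
  (hf.continuousOn.integrableOn_compact isCompact_Icc).mono_set (cube_subset d)

lemma cube_int_deriv {d : ℕ} {E : Type*} [NormedAddCommGroup E] [NormedSpace ℝ E]
    (g : (Fin d → ℝ) → E) (hg : ContDiff ℝ 1 g) (hp : PerE g) (j : Fin d) :
    ∫ x in cube d, fderiv ℝ g x (Pi.single j 1) = 0 := by
  obtain ⟨n, rfl⟩ : ∃ n, d = n + 1 := ⟨d - 1, by have := j.pos; omega⟩
  rw [setIntegral_congr_set (cube_ae _)]
  have hder : Continuous fun x => fderiv ℝ g x (Pi.single j 1) :=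
    (hg.continuous_fderiv (by norm_num)).clm_apply continuous_const
  have key := integral_divergence_of_hasFDerivAt_off_countable' (E := E) (0 : Fin (n+1) → ℝ) 1
    (by intro i; simp) (fun i x => if i = j then g x else 0)
    (fun i x => if i = j then fderiv ℝ g x else 0) ∅ Set.countable_empty
    (by
      intro i
      by_cases h : i = j
      · simp only [h, if_true]; exact hg.continuous.continuousOn
      · simp only [h, if_false]; exact continuousOn_const)
    (by
      intro x _ i
      by_cases h : i = j
      · simp only [h, if_true]; exact (hg.differentiable (by norm_num) x).hasFDerivAt
      · simp only [h, if_false]; exact hasFDerivAt_const _ _)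
    (by
      have : (fun x : Fin (n+1) → ℝ => ∑ i, (if i = j then fderiv ℝ g x else 0) (Pi.single i 1))
          = fun x => fderiv ℝ g x (Pi.single j 1) := by
        funext x
        rw [Finset.sum_eq_single j]
        · simp
        · intro b _ hb; simp [hb]
        · simp
      rw [this]
      exact hder.continuousOn.integrableOn_compact isCompact_Icc)
  have e1 : ∀ x : Fin (n+1) → ℝ, ∑ i, (if i = j then fderiv ℝ g x else 0) (Pi.single i 1)
      = fderiv ℝ g x (Pi.single j 1) := by
    intro x
    rw [Finset.sum_eq_single j]
    · simp
    · intro b _ hb; simp [hb]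
    · simp
  simp only [e1] at key
  rw [key]
  refine Finset.sum_eq_zero fun i _ => ?_
  by_cases h : i = j
  · subst h
    simp only [if_true]
    rw [sub_eq_zero]
    refine integral_congr_ae (Filter.Eventually.of_forall fun x => ?_)
    have := hp (i.insertNth (0:ℝ) x) (Pi.single i 1)
    simp only [Pi.one_apply, Pi.zero_apply]
    rw [← this]
    congr 1
    ext l
    rcases Fin.eq_self_or_eq_succAbove i l with rfl | ⟨l', rfl⟩
    · simp
    · simp
  · simp [h]

/-- exponentials -/
def ee {d : ℕ} (k : Fin d → ℤ) (x : Fin d → ℝ) : ℂ :=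
  Complex.exp (2 * Real.pi * Complex.I * ∑ j, (k j : ℂ) * (x j : ℂ))

lemma ee_add {d : ℕ} (k l : Fin d → ℤ) (x : Fin d → ℝ) : ee (k + l) x = ee k x * ee l x := by
  unfold ee
  rw [← Complex.exp_add, ← mul_add, ← Finset.sum_add_distrib]
  congr 3
  funext j
  push_cast [Pi.add_apply]
  ring

lemma ee_zero {d : ℕ} (x : Fin d → ℝ) : ee 0 x = 1 := by
  simp [ee]

lemma ee_norm {d : ℕ} (k : Fin d → ℤ) (x : Fin d → ℝ) : ‖ee k x‖ = 1 := by
  unfold ee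
  have : (2 * Real.pi * Complex.I * ∑ j, (k j : ℂ) * (x j : ℂ))
      = ((2 * Real.pi * ∑ j, (k j : ℝ) * x j : ℝ) : ℂ) * Complex.I := by
    push_cast; ring
  rw [this, Complex.norm_exp_ofReal_mul_I]

lemma ee_conj {d : ℕ} (k : Fin d → ℤ) (x : Fin d → ℝ) :
    (starRingEnd ℂ) (ee k x) = ee (-k) x := by
  unfold ee
  rw [← Complex.exp_conj]
  congr 1
  simp [Complex.conj_ofNat]

lemma ee_per {d : ℕ} (k : Fin d → ℤ) : PerE (ee k) := by
  intro x ν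
  unfold ee
  rw [Complex.exp_eq_exp_iff_exists_int]
  refine ⟨∑ j, k j * ν j, ?_⟩
  push_cast [Pi.add_apply]
  simp only [mul_add, Finset.sum_add_distrib]
  ring

/-- derivative functional of `ee k` -/
def eL {d : ℕ} (k : Fin d → ℤ) : (Fin d → ℝ) →L[ℝ] ℂ :=
  ∑ j, (2 * Real.pi * Complex.I * (k j : ℂ)) • (Complex.ofRealCLM.comp (ContinuousLinearMap.proj j))

lemma eL_apply {d : ℕ} (k : Fin d → ℤ) (v : Fin d → ℝ) :
    eL k v = 2 * Real.pi * Complex.I * ∑ j, (k j : ℂ) * (v j : ℂ) := by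
  simp [eL, Finset.mul_sum, mul_assoc]

lemma eL_single {d : ℕ} (k : Fin d → ℤ) (j : Fin d) :
    eL k (Pi.single j 1) = 2 * Real.pi * Complex.I * (k j : ℂ) := by
  rw [eL_apply]
  congr 1
  rw [Finset.sum_eq_single j]
  · simp
  · intro b _ hb; simp [hb]
  · simp

lemma ee_hasFDerivAt {d : ℕ} (k : Fin d → ℤ) (x : Fin d → ℝ) :
    HasFDerivAt (ee k) (ee k x • eL k) x := by
  have h1 : HasFDerivAt (fun x => eL k x) (eL k) x := (eL k).hasFDerivAt
  have h2 := h1.cexp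
  simp only [eL_apply] at h2
  exact h2

lemma ee_contDiff {d : ℕ} (k : Fin d → ℤ) (n : WithTop ℕ∞) : ContDiff ℝ n (ee k) := by
  have h : ContDiff ℝ n (fun x => Complex.exp (eL k x)) := (eL k).contDiff.cexp
  simp only [eL_apply] at h
  exact h

lemma ee_continuous {d : ℕ} (k : Fin d → ℤ) : Continuous (ee k) := (ee_contDiff k 0).continuous

/-- Fourier coefficients -/
def hat {d : ℕ} (h : (Fin d → ℝ) → ℂ) (k : Fin d → ℤ) : ℂ :=
  ∫ x in cube d, h x * ee (-k) x

lemma int_ee {d : ℕ} (k : Fin d → ℤ) : ∫ x in cube d, ee k x = if k = 0 then 1 else 0 := by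
  by_cases hk : k = 0
  · subst hk
    simp only [ee_zero, if_true]
    rw [setIntegral_const, cube_vol]
    simp
  · rw [if_neg hk]
    obtain ⟨j, hj⟩ := Function.ne_iff.mp hk
    have h := cube_int_deriv (ee k) (ee_contDiff k 1) (ee_per k) j
    simp only [(ee_hasFDerivAt k _).fderiv, _root_.smul_apply, eL_single, smul_eq_mul] at h
    rw [integral_mul_const] at h
    rcases mul_eq_zero.mp h with h | h
    · exact h
    · exfalso
      have : (k j : ℂ) ≠ 0 := by exact_mod_cast hj
      simp [Real.pi_ne_zero] at h
      exact hj (by simpa using h)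

lemma hat_mul_ee {d : ℕ} (h : (Fin d → ℝ) → ℂ) (k l : Fin d → ℤ) :
    hat (fun x => h x * ee l x) k = hat h (k - l) := by
  unfold hat
  congr 1
  funext x
  rw [mul_assoc, ← ee_add]
  congr 2
  abel

lemma hat_ee {d : ℕ} (k l : Fin d → ℤ) : hat (ee l) k = if k = l then 1 else 0 := by
  unfold hat
  simp only [← ee_add, int_ee]
  have : l + -k = 0 ↔ k = l := by rw [← sub_eq_add_neg, sub_eq_zero, eq_comm]
  simp only [this]

lemma hat_one {d : ℕ} (k : Fin d → ℤ) : hat (fun _ : Fin d → ℝ => (1:ℂ)) k = if k = 0 then 1 else 0 := by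
  rw [← hat_ee]
  congr 1
  funext x
  rw [ee_zero]

lemma hat_const {d : ℕ} (c : ℂ) (k : Fin d → ℤ) :
    hat (fun _ : Fin d → ℝ => c) k = if k = 0 then c else 0 := by
  have := hat_one (d := d) k
  unfold hat at *
  rw [integral_const_mul]
  simp only [one_mul] at this
  rw [this]
  split_ifs <;> simp

lemma hat_bound {d : ℕ} (h : (Fin d → ℝ) → ℂ) (k : Fin d → ℤ) :
    ‖hat h k‖ ≤ ∫ x in cube d, ‖h x‖ := by
  unfold hat
  refine (norm_integral_le_integral_norm _).trans (le_of_eq ?_)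
  congr 1
  funext x
  rw [norm_mul, ee_norm, mul_one]

lemma hat_deriv {d : ℕ} (h : (Fin d → ℝ) → ℂ) (hh : ContDiff ℝ 1 h) (hp : PerE h) (j : Fin d)
    (k : Fin d → ℤ) :
    hat (fun x => fderiv ℝ h x (Pi.single j 1)) k = 2 * Real.pi * Complex.I * (k j : ℂ) * hat h k := by
  have h1 : ContDiff ℝ 1 (fun x => h x * ee (-k) x) := hh.mul (ee_contDiff _ _)
  have h2 : PerE (fun x => h x * ee (-k) x) := fun x ν => by
    simp only; rw [hp x ν, ee_per (-k) x ν]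
  have h3 := cube_int_deriv _ h1 h2 j
  have h4 : ∀ x, fderiv ℝ (fun x => h x * ee (-k) x) x (Pi.single j 1)
      = fderiv ℝ h x (Pi.single j 1) * ee (-k) x
        + (- (2 * Real.pi * Complex.I * (k j : ℂ))) * (h x * ee (-k) x) := by
    intro x
    have := ((hh.differentiable (by norm_num) x).hasFDerivAt).mul (ee_hasFDerivAt (-k) x)
    have h5 : fderiv ℝ (fun x => h x * ee (-k) x) x = _ := this.fderiv
    rw [h5]
    simp only [_root_.add_apply, _root_.smul_apply, eL_single, smul_eq_mul]
    push_cast [Pi.neg_apply]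
    ring
  simp only [h4] at h3
  rw [integral_add, integral_const_mul] at h3
  · unfold hat
    linear_combination h3
  · refine cube_integrable ?_
    exact ((hh.continuous_fderiv (by norm_num)).clm_apply continuous_const).mul (ee_continuous _)
  · exact (cube_integrable h1.continuous).const_mul _

lemma PerE.fderiv {d : ℕ} {E : Type*} [NormedAddCommGroup E] [NormedSpace ℝ E]
    {h : (Fin d → ℝ) → E} (hp : PerE h) (v : Fin d → ℝ) :
    PerE (fun x => fderiv ℝ h x v) := by
  intro x ν
  have : (fun y => h (y + fun i => (ν i : ℝ))) = h := funext fun y => hp y ν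
  have h2 := fderiv_comp_add_right (𝕜 := ℝ) (f := h) (x := x) (fun i => (ν i : ℝ))
  rw [this] at h2
  simp only
  rw [← h2]

/-- Japanese bracket -/
def jb {d : ℕ} (k : Fin d → ℤ) : ℝ := 1 + ‖k‖

lemma jb_one_le {d : ℕ} (k : Fin d → ℤ) : 1 ≤ jb k := by
  unfold jb; linarith [norm_nonneg k]

lemma jb_pos {d : ℕ} (k : Fin d → ℤ) : 0 < jb k := lt_of_lt_of_le one_pos (jb_one_le k)

lemma abs_le_norm {d : ℕ} (k : Fin d → ℤ) (j : Fin d) : |(k j : ℝ)| ≤ ‖k‖ := by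
  have := norm_le_pi_norm k j
  rwa [Int.norm_eq_abs] at this

lemma hat_decay_aux {d : ℕ} (N : ℕ) (j : Fin d) : ∀ (h : (Fin d → ℝ) → ℂ),
    ContDiff ℝ (⊤ : ℕ∞) h → PerE h → ∃ C, ∀ k, |(k j : ℝ)| ^ N * ‖hat h k‖ ≤ C := by
  induction N with
  | zero =>
    intro h hh hp
    exact ⟨∫ x in cube d, ‖h x‖, fun k => by simpa using hat_bound h k⟩
  | succ N ih =>
    intro h hh hp
    have h1 : ContDiff ℝ (⊤ : ℕ∞) (fun x => fderiv ℝ h x (Pi.single j 1)) :=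
      (hh.fderiv_right (m := (⊤ : ℕ∞)) (by simp)).clm_apply contDiff_const
    obtain ⟨C, hC⟩ := ih _ h1 (hp.fderiv _)
    refine ⟨C, fun k => (le_trans ?_ (hC k))⟩
    rw [hat_deriv h (hh.of_le (by exact_mod_cast le_top)) hp, norm_mul, norm_mul]
    have h2 : ‖(2 * Real.pi * Complex.I : ℂ)‖ = 2 * Real.pi := by
      simp [abs_of_pos Real.pi_pos]
    have h3 : ‖((k j : ℤ) : ℂ)‖ = |(k j : ℝ)| := by simp
    rw [h2, h3, pow_succ, mul_assoc]
    refine mul_le_mul_of_nonneg_left ?_ (by positivity)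
    have : 1 ≤ 2 * Real.pi := by linarith [Real.pi_gt_three]
    have h4 : 0 ≤ |(k j : ℝ)| * ‖hat h k‖ := by positivity
    nlinarith

lemma hat_decay {d : ℕ} (h : (Fin d → ℝ) → ℂ) (hh : ContDiff ℝ (⊤ : ℕ∞) h) (hp : PerE h) (N : ℕ) :
    ∃ C, 0 ≤ C ∧ ∀ k, ‖hat h k‖ ≤ C * (jb k ^ N)⁻¹ := by
  choose C hC using fun j : Fin d => hat_decay_aux N j h hh hp
  set C0 := ∫ x in cube d, ‖h x‖ with hC0
  have hC0' : ∀ k, ‖hat h k‖ ≤ C0 := hat_bound h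
  have hC00 : 0 ≤ C0 := (norm_nonneg _).trans (hC0' 0)
  have hCj : ∀ j, 0 ≤ C j := fun j => le_trans (by positivity) (hC j 0)
  have hS : 0 ≤ ∑ j, C j := Finset.sum_nonneg fun j _ => hCj j
  refine ⟨2 ^ N * (C0 + ∑ j, C j), by positivity, fun k => ?_⟩
  rw [← div_eq_mul_inv, le_div_iff₀ (pow_pos (jb_pos k) N)]
  by_cases hk : ‖k‖ ≤ 1
  · have h1 : jb k ^ N ≤ 2 ^ N := by
      have := jb_pos k
      gcongr
      unfold jb; linarith
    calc ‖hat h k‖ * jb k ^ N ≤ C0 * 2 ^ N := by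
          exact mul_le_mul (hC0' k) h1 (pow_nonneg (jb_pos k).le N) hC00
      _ ≤ _ := by
          have : (0:ℝ) < 2 ^ N := by positivity
          nlinarith
  · push Not at hk
    obtain ⟨j, hj⟩ : ∃ j, ‖k‖ = |(k j : ℝ)| := by
      by_contra hcon
      push Not at hcon
      have : ‖k‖ < ‖k‖ := by
        refine (pi_norm_lt_iff (by linarith)).mpr fun j => ?_
        rw [Int.norm_eq_abs]
        exact lt_of_le_of_ne (abs_le_norm k j) (hcon j).symm
      exact lt_irrefl _ this
    have h1 : jb k ^ N ≤ 2 ^ N * |(k j : ℝ)| ^ N := by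
      rw [← mul_pow, ← hj]
      have := jb_pos k
      gcongr
      unfold jb; linarith
    calc ‖hat h k‖ * jb k ^ N ≤ ‖hat h k‖ * (2 ^ N * |(k j : ℝ)| ^ N) := by gcongr
      _ = 2 ^ N * (|(k j : ℝ)| ^ N * ‖hat h k‖) := by ring
      _ ≤ 2 ^ N * C j := by gcongr; exact hC j k
      _ ≤ 2 ^ N * (C0 + ∑ j, C j) := by
          gcongr
          have := Finset.single_le_sum (f := C) (fun i _ => hCj i) (Finset.mem_univ j)
          linarith

lemma summable_prod_aux (n : ℕ) :
    Summable fun k : Fin n → ℤ => ∏ j, ((1 + |(k j : ℝ)|) ^ 2)⁻¹ := by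
  induction n with
  | zero => exact Summable.of_finite
  | succ n ih =>
    have h1 : Summable fun z : ℤ => ((1 + |(z : ℝ)|) ^ 2)⁻¹ := by
      have := (Real.summable_one_div_int_pow (p := 2)).mpr (by norm_num)
      have h2 : Summable fun z : ℤ => 1 / (z : ℝ) ^ 2 + if z = 0 then 1 else 0 :=
        this.add (summable_of_ne_finset_zero (s := {0}) (by intro b hb; simp at hb; simp [hb]))
      refine Summable.of_nonneg_of_le (fun z => by positivity) (fun z => ?_) h2
      by_cases hz : z = 0
      · simp [hz]
      · simp only [hz, if_false, add_zero, one_div]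
        have : (0:ℝ) < (z:ℝ)^2 := by positivity
        refine inv_anti₀ this ?_
        rw [← sq_abs (z:ℝ)]
        gcongr
        linarith
    have h3 := h1.mul_of_nonneg ih (fun z => by positivity) (fun k => by
      change (0:ℝ) ≤ _
      positivity)
    rw [← (Fin.consEquiv (fun _ : Fin (n+1) => ℤ)).summable_iff]
    refine h3.congr fun p => ?_
    simp [Fin.prod_univ_succ, Fin.consEquiv, mul_comm]

lemma summable_jb (d : ℕ) : Summable fun k : Fin d → ℤ => (jb k ^ (2 * d))⁻¹ := by
  refine Summable.of_nonneg_of_le (fun k => by have := jb_pos k; positivity) (fun k => ?_)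
    (summable_prod_aux d)
  rw [Finset.prod_inv_distrib]
  have : ∏ j : Fin d, (1 + |(k j : ℝ)|) ^ 2 ≤ jb k ^ (2 * d) := by
    calc ∏ j : Fin d, (1 + |(k j : ℝ)|) ^ 2 ≤ ∏ j : Fin d, (jb k) ^ 2 := by
          refine Finset.prod_le_prod (fun j _ => by positivity) (fun j _ => ?_)
          unfold jb
          gcongr
          exact abs_le_norm k j
      _ = _ := by simp [← pow_mul]
  have h2 : 0 < ∏ j : Fin d, (1 + |(k j : ℝ)|) ^ 2 := by positivity
  gcongr



lemma hat_unique {d : ℕ} (h : (Fin d → ℝ) → ℂ) (hc : Continuous h) (hp : PerE h)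
    (h0 : ∀ k, hat h k = 0) : ∀ x, h x = 0 := by
  let π : (Fin d → ℝ) → UnitAddTorus (Fin d) := fun x i => ((x i : ℝ) : UnitAddCircle)
  have hπ : IsOpenQuotientMap π := by
    have h1 : IsOpenQuotientMap (fun x : ℝ => (x : UnitAddCircle)) :=
      QuotientAddGroup.isOpenQuotientMap_mk
    exact IsOpenQuotientMap.piMap (fun _ => h1)
  have hfac : ∀ x y, π x = π y → h x = h y := by
    intro x y hxy
    have h1 : ∀ i, ∃ n : ℤ, x i = y i + n := by
      intro i
      have := congrFun hxy i
      simp only [π] at this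
      rw [← sub_eq_zero, ← AddCircle.coe_sub, AddCircle.coe_eq_zero_iff] at this
      obtain ⟨n, hn⟩ := this
      refine ⟨n, ?_⟩
      rw [zsmul_eq_mul, mul_one] at hn
      rw [hn]; ring
    choose ν hν using h1
    rw [← hp y ν]
    congr 1
    funext i
    exact hν i
  choose s hs using hπ.surjective
  have hsx : ∀ x, h (s (π x)) = h x := fun x => hfac _ _ (hs _)
  have hF : Continuous (fun y => h (s y)) := by
    rw [hπ.isQuotientMap.continuous_iff]
    have : (fun y => h (s y)) ∘ π = h := funext hsx
    rwa [this]
  let F : C(UnitAddTorus (Fin d), ℂ) := ⟨fun y => h (s y), hF⟩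
  have hee : ∀ (k : Fin d → ℤ) x, UnitAddTorus.mFourier k (π x) = ee k x := by
    intro k x
    simp only [UnitAddTorus.mFourier, ContinuousMap.coe_mk, π, ee]
    simp only [fourier_coe_apply]
    rw [← Complex.exp_sum, Finset.mul_sum]
    congr 1
    refine Finset.sum_congr rfl fun j _ => ?_
    push_cast
    ring
  have hco : UnitAddTorus.mFourierCoeff F = 0 := by
    funext k
    rw [UnitAddTorus.mFourierCoeff_eq_integral _ _ 0]
    have h1 : {x : Fin d → ℝ | ∀ i, x i ∈ Set.Ioc ((0 : Fin d → ℝ) i) ((0 : Fin d → ℝ) i + 1)}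
        =ᵐ[volume] cube d := by
      have e1 : {x : Fin d → ℝ | ∀ i, x i ∈ Set.Ioc ((0 : Fin d → ℝ) i) ((0 : Fin d → ℝ) i + 1)}
        = Set.pi Set.univ fun i => Set.Ioc ((0 : Fin d → ℝ) i) ((1 : Fin d → ℝ) i) := by
        ext x; simp
      rw [e1]
      exact (Measure.univ_pi_Ioc_ae_eq_Icc (μ := fun _ : Fin d => (volume : Measure ℝ))).trans
        (cube_ae d).symm
    rw [setIntegral_congr_set h1]
    rw [Pi.zero_apply, ← h0 k]
    unfold hat
    congr 1
    funext x
    have h2 := hee (-k) x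
    simp only [π] at h2
    have h3 := hsx x
    simp only [π] at h3
    rw [h2, smul_eq_mul, mul_comm]
    congr 1
  intro x
  have := UnitAddTorus.hasSum_mFourier_series_apply_of_summable (f := F)
    (by rw [hco]; exact summable_zero) (π x)
  rw [hco] at this
  simp only [Pi.zero_apply, zero_smul] at this
  have h2 := this.unique hasSum_zero
  rw [← hsx x]
  exact h2



lemma pd_add {d : ℕ} {f g : (Fin d → ℝ) → ℝ} (hf : Differentiable ℝ f) (hg : Differentiable ℝ g)
    (j : Fin d) (x : Fin d → ℝ) : pd (fun y => f y + g y) j x = pd f j x + pd g j x := by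
  unfold pd
  rw [fderiv_fun_add (hf x) (hg x)]; rfl

lemma pd_mul {d : ℕ} {f g : (Fin d → ℝ) → ℝ} (hf : Differentiable ℝ f) (hg : Differentiable ℝ g)
    (j : Fin d) (x : Fin d → ℝ) :
    pd (fun y => f y * g y) j x = pd f j x * g x + f x * pd g j x := by
  unfold pd
  rw [fderiv_fun_mul (hf x) (hg x)]
  simp
  ring

lemma pd_const_mul {d : ℕ} {f : (Fin d → ℝ) → ℝ} (hf : Differentiable ℝ f) (c : ℝ)
    (j : Fin d) (x : Fin d → ℝ) : pd (fun y => c * f y) j x = c * pd f j x := by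
  rw [pd_mul (differentiable_const c) hf]
  simp [pd]

lemma pd_contDiff {d : ℕ} {f : (Fin d → ℝ) → ℝ} {n : WithTop ℕ∞} {k : WithTop ℕ∞}
    (hf : ContDiff ℝ n f) (hn : k + 1 ≤ n) (j : Fin d) : ContDiff ℝ k (fun x => pd f j x) :=
  (hf.fderiv_right hn).clm_apply contDiff_const

lemma pd_cont {d : ℕ} {f : (Fin d → ℝ) → ℝ} (hf : ContDiff ℝ 1 f) (j : Fin d) :
    Continuous (fun x => pd f j x) :=
  (pd_contDiff (k := 0) hf (by simp) j).continuous

lemma pd_C1 {d : ℕ} {f : (Fin d → ℝ) → ℝ} (hf : ContDiff ℝ 2 f) (j : Fin d) :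
    ContDiff ℝ 1 (fun x => pd f j x) :=
  pd_contDiff hf (by norm_num) j

lemma pd2_cont {d : ℕ} {f : (Fin d → ℝ) → ℝ} (hf : ContDiff ℝ 2 f) (j k : Fin d) :
    Continuous (fun x => pd2 f j k x) := pd_cont (pd_C1 hf j) k

lemma pd_per {d : ℕ} {f : (Fin d → ℝ) → ℝ} (hf : Per f) (j : Fin d) : Per (fun x => pd f j x) :=
  PerE.fderiv (E := ℝ) hf _

lemma Per.mul {d : ℕ} {f g : (Fin d → ℝ) → ℝ} (hf : Per f) (hg : Per g) :
    Per (fun x => f x * g x) := fun x ν => by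
  simp only; rw [hf x ν, hg x ν]

lemma tInt_pd {d : ℕ} {g : (Fin d → ℝ) → ℝ} (hg : ContDiff ℝ 1 g) (hp : Per g) (j : Fin d) :
    tInt (fun x => pd g j x) = 0 := cube_int_deriv g hg hp j

lemma jump_eq {d m : ℕ} (q : Fin m → Fin m → (Fin d → ℝ) → ℝ)
    (hq_diag : ∀ α x, q α α x = -∑ β ∈ Finset.univ.filter (fun β => β ≠ α), q α β x)
    (f : (Fin d → ℝ) → Fin m → ℝ) (x : Fin d → ℝ) (α : Fin m) :
    jumpOp q f x α = ∑ β, q α β x * f x β := by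
  unfold jumpOp
  rw [← Finset.sum_filter_add_sum_filter_not Finset.univ (fun β => β ≠ α) (fun β => q α β x * f x β)]
  have : (Finset.univ.filter fun β => ¬ (β ≠ α)) = {α} := by ext β; simp
  rw [this, Finset.sum_singleton, hq_diag]
  simp only [mul_sub, Finset.sum_sub_distrib, ← Finset.sum_mul]
  ring

lemma tInt_cont_add {d : ℕ} {f g : (Fin d → ℝ) → ℝ} (hf : Continuous f) (hg : Continuous g) :
    tInt (fun x => f x + g x) = tInt f + tInt g :=
  integral_add (cube_integrable hf) (cube_integrable hg)

lemma tInt_cont_sum {d : ℕ} {ι : Type*} (s : Finset ι) {f : ι → (Fin d → ℝ) → ℝ}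
    (hf : ∀ i ∈ s, Continuous (f i)) :
    tInt (fun x => ∑ i ∈ s, f i x) = ∑ i ∈ s, tInt (f i) :=
  integral_finsetSum s (fun i hi => cube_integrable (hf i hi))

lemma tInt_const_mul {d : ℕ} (c : ℝ) (f : (Fin d → ℝ) → ℝ) :
    tInt (fun x => c * f x) = c * tInt f := integral_const_mul c f

lemma gen_cont {d m : ℕ} {b : (Fin d → ℝ) → Fin m → Fin d → ℝ}
    {a : (Fin d → ℝ) → Fin m → Matrix (Fin d) (Fin d) ℝ}
    {q : Fin m → Fin m → (Fin d → ℝ) → ℝ} {f : (Fin d → ℝ) → Fin m → ℝ}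
    (hb : ∀ α j, Continuous fun x => b x α j) (ha : ∀ α j k, Continuous fun x => a x α j k)
    (hq : ∀ α β, α ≠ β → Continuous (q α β)) (hf : ∀ α, ContDiff ℝ 2 fun x => f x α) (α : Fin m) :
    Continuous fun x => gen b a q f x α := by
  unfold gen jumpOp
  refine ((continuous_finsetSum _ fun j _ => ?_).add (continuous_const.mul
    (continuous_finsetSum _ fun j _ => continuous_finsetSum _ fun k _ => ?_))).add
    (continuous_finsetSum _ fun β hβ => ?_)
  · exact (hb α j).mul (pd_cont ((hf α).of_le (by norm_num)) j)
  · exact (ha α j k).mul (pd2_cont (hf α) j k)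
  · exact (hq α β (Finset.mem_filter.mp hβ).2.symm).mul
      ((hf β).continuous.sub (hf α).continuous)

lemma pairing {d m : ℕ} {b : (Fin d → ℝ) → Fin m → Fin d → ℝ}
    {a : (Fin d → ℝ) → Fin m → Matrix (Fin d) (Fin d) ℝ}
    {q : Fin m → Fin m → (Fin d → ℝ) → ℝ}
    (hb : ∀ α j, ContDiff ℝ 2 fun x => b x α j) (ha : ∀ α j k, ContDiff ℝ 2 fun x => a x α j k)
    (hq : ∀ α β, α ≠ β → Continuous (q α β))
    (hq_diag : ∀ α x, q α α x = -∑ β ∈ Finset.univ.filter (fun β => β ≠ α), q α β x)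
    (hbp : ∀ α j, Per fun x => b x α j) (hap : ∀ α j k, Per fun x => a x α j k)
    (hsym : ∀ x α j k, a x α j k = a x α k j)
    {M : (Fin d → ℝ) → Fin m → ℝ}
    (hM_C2 : ∀ α, ContDiff ℝ 2 fun x => M x α)
    (hM_per : ∀ α, Per fun x => M x α)
    (hM_inv : ∀ x α, genAdj b a q M x α = 0)
    {u : (Fin d → ℝ) → Fin m → ℝ} (hu : ∀ α, ContDiff ℝ 2 fun x => u x α)
    (hup : ∀ α, Per fun x => u x α) :
    ∑ α, tInt (fun x => M x α * gen b a q u x α) = 0 := by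
  have dM : ∀ α, Differentiable ℝ fun x => M x α := fun α => (hM_C2 α).differentiable (by norm_num)
  have du : ∀ α, Differentiable ℝ fun x => u x α := fun α => (hu α).differentiable (by norm_num)
  have hbM : ∀ α j, ContDiff ℝ 2 fun x => b x α j * M x α := fun α j => (hb α j).mul (hM_C2 α)
  have haM : ∀ α j k, ContDiff ℝ 2 fun x => a x α j k * M x α := fun α j k => (ha α j k).mul (hM_C2 α)
  have hbMu : ∀ α j, ContDiff ℝ 1 fun x => (b x α j * M x α) * u x α := fun α j =>
    ((hbM α j).mul (hu α)).of_le (by norm_num)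
  have hg1 : ∀ α j k, ContDiff ℝ 1 fun x => (a x α j k * M x α) * pd (fun y => u y α) j x :=
    fun α j k => ((haM α j k).of_le (by norm_num)).mul (pd_C1 (hu α) j)
  have hg2 : ∀ α j k, ContDiff ℝ 1 fun x => u x α * pd (fun y => a y α j k * M y α) j x :=
    fun α j k => ((hu α).of_le (by norm_num)).mul (pd_C1 (haM α j k) j)
  have dd : ∀ {f : (Fin d → ℝ) → ℝ}, ContDiff ℝ 2 f → Differentiable ℝ f :=
    fun h => h.differentiable (by norm_num)
  have dd1 : ∀ {f : (Fin d → ℝ) → ℝ}, ContDiff ℝ 1 f → Differentiable ℝ f :=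
    fun h => h.differentiable (by norm_num)
  let V : Fin m → (Fin d → ℝ) → ℝ := fun α x =>
    (∑ j, pd (fun x => (b x α j * M x α) * u x α) j x)
    + ((1/2) * ∑ j, ∑ k, pd (fun x => (a x α j k * M x α) * pd (fun y => u y α) j x) k x
      + (-1/2) * ∑ j, ∑ k, pd (fun x => u x α * pd (fun y => a y α j k * M y α) j x) k x)
  have hVc1 : ∀ α, Continuous fun x => ∑ j, pd (fun x => (b x α j * M x α) * u x α) j x :=
    fun α => continuous_finsetSum _ fun j _ => pd_cont (hbMu α j) j
  have hVc2 : ∀ α, Continuous fun x => ∑ j, ∑ k, pd (fun x => (a x α j k * M x α) * pd (fun y => u y α) j x) k x :=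
    fun α => continuous_finsetSum _ fun j _ => continuous_finsetSum _ fun k _ => pd_cont (hg1 α j k) k
  have hVc3 : ∀ α, Continuous fun x => ∑ j, ∑ k, pd (fun x => u x α * pd (fun y => a y α j k * M y α) j x) k x :=
    fun α => continuous_finsetSum _ fun j _ => continuous_finsetSum _ fun k _ => pd_cont (hg2 α j k) k
  have hVc2' : ∀ α, Continuous fun x => (1/2 : ℝ) * ∑ j, ∑ k, pd (fun x => (a x α j k * M x α) * pd (fun y => u y α) j x) k x :=
    fun α => continuous_const.mul (hVc2 α)
  have hVc3' : ∀ α, Continuous fun x => (-1/2 : ℝ) * ∑ j, ∑ k, pd (fun x => u x α * pd (fun y => a y α j k * M y α) j x) k x :=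
    fun α => continuous_const.mul (hVc3 α)
  have hVc23 : ∀ α, Continuous fun x => (1/2 : ℝ) * ∑ j, ∑ k, pd (fun x => (a x α j k * M x α) * pd (fun y => u y α) j x) k x
      + (-1/2 : ℝ) * ∑ j, ∑ k, pd (fun x => u x α * pd (fun y => a y α j k * M y α) j x) k x :=
    fun α => (hVc2' α).add (hVc3' α)
  have hV0 : ∀ α, tInt (V α) = 0 := by
    intro α
    simp only [V]
    rw [tInt_cont_add (hVc1 α) (hVc23 α), tInt_cont_add (hVc2' α) (hVc3' α),
      tInt_const_mul, tInt_const_mul, tInt_cont_sum _ (fun j _ => pd_cont (hbMu α j) j),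
      tInt_cont_sum _ (fun j _ => continuous_finsetSum _ fun k _ => pd_cont (hg1 α j k) k),
      tInt_cont_sum _ (fun j _ => continuous_finsetSum _ fun k _ => pd_cont (hg2 α j k) k)]
    have e1 : ∀ j, tInt (fun x => pd (fun x => (b x α j * M x α) * u x α) j x) = 0 := fun j =>
      tInt_pd (hbMu α j) (((hbp α j).mul (hM_per α)).mul (hup α)) j
    have e2 : ∀ j, tInt (fun x => ∑ k, pd (fun x => (a x α j k * M x α) * pd (fun y => u y α) j x) k x) = 0 := by
      intro j
      rw [tInt_cont_sum _ (fun k _ => pd_cont (hg1 α j k) k)]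
      refine Finset.sum_eq_zero fun k _ => ?_
      exact tInt_pd (hg1 α j k) (((hap α j k).mul (hM_per α)).mul (pd_per (hup α) j)) k
    have e3 : ∀ j, tInt (fun x => ∑ k, pd (fun x => u x α * pd (fun y => a y α j k * M y α) j x) k x) = 0 := by
      intro j
      rw [tInt_cont_sum _ (fun k _ => pd_cont (hg2 α j k) k)]
      refine Finset.sum_eq_zero fun k _ => ?_
      exact tInt_pd (hg2 α j k) ((hup α).mul (pd_per ((hap α j k).mul (hM_per α)) j)) k
    simp only [e1, e2, e3]
    simp
  have hVc : ∀ α, Continuous (V α) := fun α =>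
    (hVc1 α).add ((continuous_const.mul (hVc2 α)).add (continuous_const.mul (hVc3 α)))
  have hpt : ∀ x, ∑ α, M x α * gen b a q u x α = ∑ α, V α x := by
    intro x
    have h1 : ∀ α, V α x = M x α * (gen b a q u x α - ∑ β, q α β x * u x β)
        - u x α * (genAdj b a q M x α - ∑ β, q β α x * M x β) := by
      intro α
      simp only [V, gen, genAdj, jump_eq q hq_diag]
      have s1 : ∀ j, pd (fun x => (b x α j * M x α) * u x α) j x
          = pd (fun x => b x α j * M x α) j x * u x α + b x α j * M x α * pd (fun y => u y α) j x :=
        fun j => pd_mul (dd (hbM α j)) (du α) j x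
      have s2 : ∀ j k, pd (fun x => (a x α j k * M x α) * pd (fun y => u y α) j x) k x
          = pd (fun x => a x α j k * M x α) k x * pd (fun y => u y α) j x
            + a x α j k * M x α * pd2 (fun y => u y α) j k x :=
        fun j k => pd_mul (dd (haM α j k)) (dd1 (pd_C1 (hu α) j)) k x
      have s3 : ∀ j k, pd (fun x => u x α * pd (fun y => a y α j k * M y α) j x) k x
          = pd (fun y => u y α) k x * pd (fun y => a y α j k * M y α) j x
            + u x α * pd2 (fun y => a y α j k * M y α) j k x :=
        fun j k => pd_mul (du α) (dd1 (pd_C1 (haM α j k) j)) k x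
      have s4 : ∑ j, ∑ k, pd (fun x => a x α j k * M x α) k x * pd (fun y => u y α) j x
          = ∑ j, ∑ k, pd (fun y => u y α) k x * pd (fun y => a y α j k * M y α) j x := by
        rw [Finset.sum_comm]
        refine Finset.sum_congr rfl fun j _ => Finset.sum_congr rfl fun k _ => ?_
        have : (fun x => a x α k j * M x α) = fun x => a x α j k * M x α := by
          funext y; rw [hsym y α k j]
        rw [this]; ring
      simp only [s1, s2, s3, Finset.sum_add_distrib]
      rw [s4]
      have t1 : ∑ j, pd (fun x => b x α j * M x α) j x * u x α
          = u x α * ∑ j, pd (fun x => b x α j * M x α) j x := by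
        rw [Finset.mul_sum]; exact Finset.sum_congr rfl fun j _ => by ring
      have t2 : ∑ j, b x α j * M x α * pd (fun y => u y α) j x
          = M x α * ∑ j, b x α j * pd (fun y => u y α) j x := by
        rw [Finset.mul_sum]; exact Finset.sum_congr rfl fun j _ => by ring
      have t3 : ∑ j, ∑ k, a x α j k * M x α * pd2 (fun y => u y α) j k x
          = M x α * ∑ j, ∑ k, a x α j k * pd2 (fun y => u y α) j k x := by
        simp only [Finset.mul_sum]
        exact Finset.sum_congr rfl fun j _ => Finset.sum_congr rfl fun k _ => by ring
      have t4 : ∑ j, ∑ k, u x α * pd2 (fun y => a y α j k * M y α) j k x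
          = u x α * ∑ j, ∑ k, pd2 (fun y => a y α j k * M y α) j k x := by
        simp only [Finset.mul_sum]
      rw [t1, t2, t3, t4]
      ring
    simp only [h1, hM_inv]
    have h2 : ∑ α, M x α * ∑ β, q α β x * u x β = ∑ α, u x α * ∑ β, q β α x * M x β := by
      simp only [Finset.mul_sum]
      rw [Finset.sum_comm]
      exact Finset.sum_congr rfl fun j _ => Finset.sum_congr rfl fun k _ => by ring
    simp only [mul_sub, Finset.sum_sub_distrib, h2]
    simp
  have hgc : ∀ α, Continuous fun x => M x α * gen b a q u x α := fun α =>
    (hM_C2 α).continuous.mul (gen_cont (fun α j => (hb α j).continuous)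
      (fun α j k => (ha α j k).continuous) hq hu α)
  rw [← tInt_cont_sum Finset.univ (fun α _ => hgc α)]
  simp only [hpt]
  rw [tInt_cont_sum Finset.univ (fun α _ => hVc α)]
  simp [hV0]


lemma fderiv_eq_sum {d : ℕ} (g : (Fin d → ℝ) → ℝ) (x ξ : Fin d → ℝ) :
    fderiv ℝ g x ξ = ∑ j, ξ j * pd g j x := by
  conv_lhs => rw [show ξ = ∑ j, ξ j • (Pi.single j (1:ℝ) : Fin d → ℝ) from by
    funext i; simp [Finset.sum_apply, Pi.single_apply]]
  rw [map_sum]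
  refine Finset.sum_congr rfl fun j _ => ?_
  rw [map_smul]; rfl

lemma second_test {d : ℕ} {g : (Fin d → ℝ) → ℝ} (hg : ContDiff ℝ 2 g) {x : Fin d → ℝ}
    (hx : IsLocalMax g x) (ξ : Fin d → ℝ) : ∑ j, ∑ k, ξ j * ξ k * pd2 g j k x ≤ 0 := by
  by_contra hneg
  push Not at hneg
  have hl : ∀ s : ℝ, HasDerivAt (fun s : ℝ => x + s • ξ) ξ s := by
    intro s
    simpa using ((hasDerivAt_id s).smul_const ξ).const_add x
  have key : ∀ (f : (Fin d → ℝ) → ℝ), Differentiable ℝ f → ∀ s : ℝ,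
      HasDerivAt (fun s : ℝ => f (x + s • ξ)) (∑ j, ξ j * pd f j (x + s • ξ)) s := by
    intro f hf s
    rw [← fderiv_eq_sum]
    exact (hf (x + s • ξ)).hasFDerivAt.comp_hasDerivAt s (hl s)
  have dg : Differentiable ℝ g := hg.differentiable (by norm_num)
  have d1 : deriv (fun s : ℝ => g (x + s • ξ)) = fun s => ∑ j, ξ j * pd g j (x + s • ξ) :=
    funext fun s => (key g dg s).deriv
  have d2 : deriv (deriv (fun s : ℝ => g (x + s • ξ))) 0 = ∑ j, ∑ k, ξ j * ξ k * pd2 g j k x := by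
    rw [d1]
    have := HasDerivAt.fun_sum (u := Finset.univ) (fun j _ =>
      (key (fun y => pd g j y) ((pd_C1 hg j).differentiable (by norm_num)) 0).const_mul (ξ j))
    rw [this.deriv]
    refine Finset.sum_congr rfl fun j _ => ?_
    rw [Finset.mul_sum]
    refine Finset.sum_congr rfl fun k _ => ?_
    simp only [zero_smul, add_zero, pd2]
    ring
  have cont : Continuous (fun s : ℝ => x + s • ξ) := by fun_prop
  have hmax : IsLocalMax (fun s : ℝ => g (x + s • ξ)) 0 := by
    have : Filter.Tendsto (fun s : ℝ => x + s • ξ) (nhds 0) (nhds x) := by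
      have := cont.tendsto 0
      simpa using this
    have h2 := this.eventually hx
    show ∀ᶠ s in nhds (0:ℝ), _
    simpa using h2
  have hd0 : deriv (fun s : ℝ => g (x + s • ξ)) 0 = 0 := hmax.deriv_eq_zero
  have hmin := isLocalMin_of_deriv_deriv_pos (by rw [d2]; exact hneg) hd0
    (dg.continuous.comp cont).continuousAt
  have hconst : (fun s : ℝ => g (x + s • ξ)) =ᶠ[nhds 0] fun _ => g (x + (0:ℝ) • ξ) := by
    filter_upwards [hmax, hmin] with s h1 h2
    exact le_antisymm h1 h2
  have h3 : deriv (fun s : ℝ => g (x + s • ξ)) =ᶠ[nhds 0] deriv fun _ => g (x + (0:ℝ) • ξ) :=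
    hconst.deriv
  have h4 := h3.deriv_eq
  rw [d2] at h4
  simp at h4
  linarith

lemma second_test_mat {d r : ℕ} {g : (Fin d → ℝ) → ℝ} (hg : ContDiff ℝ 2 g) {x : Fin d → ℝ}
    (hx : IsLocalMax g x) (s : Matrix (Fin d) (Fin r) ℝ) :
    ∑ j, ∑ k, (s * sᵀ) j k * pd2 g j k x ≤ 0 := by
  have : ∑ j, ∑ k, (s * sᵀ) j k * pd2 g j k x
      = ∑ l, ∑ j, ∑ k, s j l * s k l * pd2 g j k x := by
    simp only [Matrix.mul_apply, Matrix.transpose_apply, Finset.sum_mul]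
    rw [Finset.sum_comm' (s := (Finset.univ : Finset (Fin r))) (t' := Finset.univ) (s' := fun _ => Finset.univ) (by simp)]
    refine Finset.sum_congr rfl fun j _ => ?_
    rw [Finset.sum_comm]
  rw [this]
  exact Finset.sum_nonpos fun l _ => second_test hg hx (fun j => s j l)

def NN {d : ℕ} (z x : Fin d → ℝ) : ℝ := ∑ i, (x i - z i) ^ 2

lemma NN_contDiff {d : ℕ} (z : Fin d → ℝ) (n : WithTop ℕ∞) : ContDiff ℝ n (NN z) := by
  unfold NN
  fun_prop

lemma pd_coord {d : ℕ} (i j : Fin d) (z x : Fin d → ℝ) :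
    HasFDerivAt (fun x : Fin d → ℝ => x i - z i) (ContinuousLinearMap.proj (R := ℝ) (φ := fun _ : Fin d => ℝ) i) x :=
  (ContinuousLinearMap.proj (R := ℝ) (φ := fun _ : Fin d => ℝ) i).hasFDerivAt.sub_const (z i)

lemma pd_NN {d : ℕ} (z x : Fin d → ℝ) (j : Fin d) : pd (NN z) j x = 2 * (x j - z j) := by
  have h : HasFDerivAt (NN z) (∑ i, ((2:ℕ) * (x i - z i) ^ (2-1)) • (ContinuousLinearMap.proj (R := ℝ) (φ := fun _ : Fin d => ℝ) i)) x := by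
    unfold NN
    exact HasFDerivAt.fun_sum fun i _ => by
      have := (pd_coord i j z x).pow 2
      simpa using this
  unfold pd
  rw [h.fderiv]
  simp [Pi.single_apply]

lemma pd_exp {d : ℕ} {f : (Fin d → ℝ) → ℝ} (hf : Differentiable ℝ f) (x : Fin d → ℝ) (j : Fin d) :
    pd (fun x => Real.exp (f x)) j x = Real.exp (f x) * pd f j x := by
  unfold pd
  rw [((hf x).hasFDerivAt.exp).fderiv]
  simp

def bar {d : ℕ} (lam : ℝ) (z x : Fin d → ℝ) : ℝ := Real.exp (-lam * NN z x)

lemma bar_contDiff {d : ℕ} (lam : ℝ) (z : Fin d → ℝ) : ContDiff ℝ 2 (bar lam z) := by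
  unfold bar
  have := NN_contDiff z 2
  fun_prop

lemma pd_bar {d : ℕ} (lam : ℝ) (z x : Fin d → ℝ) (j : Fin d) :
    pd (bar lam z) j x = (-2 * lam) * ((x j - z j) * bar lam z x) := by
  have hN : Differentiable ℝ (NN z) := (NN_contDiff z 1).differentiable (by norm_num)
  have h := pd_exp (f := fun x => -lam * NN z x) (hN.const_mul _) x j
  have h2 : pd (fun x => -lam * NN z x) j x = -lam * pd (NN z) j x := by
    unfold pd
    rw [((hN x).hasFDerivAt.const_mul (-lam)).fderiv]
    simp
  rw [h2, pd_NN] at h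
  unfold bar
  rw [h]; ring

lemma pd2_bar {d : ℕ} (lam : ℝ) (z x : Fin d → ℝ) (j k : Fin d) :
    pd2 (bar lam z) j k x = (4 * lam ^ 2 * ((x j - z j) * (x k - z k))
      - 2 * lam * (if j = k then 1 else 0)) * bar lam z x := by
  unfold pd2
  have : (fun y => pd (bar lam z) j y) = fun y => (-2 * lam) * ((y j - z j) * bar lam z y) := by
    funext y; exact pd_bar lam z y j
  rw [this]
  have hc : Differentiable ℝ (fun y : Fin d → ℝ => y j - z j) := fun y =>
    (pd_coord j j z y).differentiableAt
  have hb : Differentiable ℝ (bar lam z) := (bar_contDiff lam z).differentiable (by norm_num)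
  have h1 : pd (fun y => (-2 * lam) * ((y j - z j) * bar lam z y)) k x
      = (-2*lam) * pd (fun y => (y j - z j) * bar lam z y) k x := by
    have hd : Differentiable ℝ (fun y : Fin d → ℝ => (y j - z j) * bar lam z y) := hc.mul hb
    unfold pd
    rw [((hd x).hasFDerivAt.const_mul (-2*lam)).fderiv]
    simp
  rw [h1, pd_mul hc hb, pd_bar]
  have h2 : pd (fun y : Fin d → ℝ => y j - z j) k x = if j = k then 1 else 0 := by
    unfold pd
    rw [(pd_coord j j z x).fderiv]
    simp [Pi.single_apply]
  rw [h2]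
  ring

lemma bar_alg {d : ℕ} (S : Matrix (Fin d) (Fin d) ℝ) (y : Fin d → ℝ) (lam h : ℝ) :
    ∑ j, ∑ k, S j k * ((4 * lam ^ 2 * (y j * y k) - 2 * lam * (if j = k then 1 else 0)) * h)
        = h * (4*lam^2 * (y ⬝ᵥ (S *ᵥ y)) - 2*lam * ∑ j, S j j) := by
  have h1 : ∀ j k, S j k * ((4 * lam ^ 2 * (y j * y k) - 2 * lam * (if j = k then 1 else 0)) * h)
      = h * (4*lam^2) * (y j * (S j k * y k)) - (if j = k then h * (2*lam) * S j k else 0) := by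
    intro j k
    split_ifs <;> ring
  simp only [h1, Finset.sum_sub_distrib, Finset.sum_ite_eq, Finset.mem_univ, if_true,
    ← Finset.mul_sum, dotProduct, mulVec]
  ring

lemma bar_num {lam ρ B d A Qb amin S T D N q : ℝ} (hl1 : 1 ≤ lam)
    (hl2 : 2*ρ*B + 2*B*d + A + Qb < 2*ρ*amin*lam) (hρ0 : 0 < ρ) (hB0 : 0 ≤ B)
    (hQb : 0 ≤ Qb) (hdd : 0 ≤ d) (h1 : amin * N ≤ T) (h2 : S ≤ B * (d + N)) (h3 : D ≤ A)
    (h4 : q ≤ Qb) (h5 : ρ ≤ N) (hA0 : 0 ≤ A) :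
        0 < (-2*lam*S) + (1/2) * (4*lam^2*T - 2*lam*D) - q := by
  have g1 : lam^2 * (amin*N) ≤ lam^2 * T := mul_le_mul_of_nonneg_left h1 (by positivity)
  have g2 : lam * S ≤ lam * (B * (d+N)) := mul_le_mul_of_nonneg_left h2 (by linarith)
  have g3 : lam * D ≤ lam * A := mul_le_mul_of_nonneg_left h3 (by linarith)
  have g4 : Qb ≤ lam * Qb := by nlinarith
  have hBd := mul_nonneg hB0 hdd
  have g5 : 0 ≤ 2*amin*lam - 2*B := by
    by_contra hh
    push Not at hh
    have : ρ * (2*amin*lam - 2*B) < 0 := mul_neg_of_pos_of_neg hρ0 hh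
    linarith
  have g6 : ρ * (2*amin*lam - 2*B) ≤ N * (2*amin*lam - 2*B) := mul_le_mul_of_nonneg_right h5 g5
  have g7 : 0 < N * (2*amin*lam - 2*B) - 2*B*d - A - Qb := by linarith
  have g8 : 0 < lam * (N * (2*amin*lam - 2*B) - 2*B*d - A - Qb) := mul_pos (by linarith) g7
  linarith

set_option maxHeartbeats 1000000 in
lemma core_max {d r : ℕ} (b : (Fin d → ℝ) → Fin d → ℝ) (s : (Fin d → ℝ) → Matrix (Fin d) (Fin r) ℝ)
    (Q v : (Fin d → ℝ) → ℝ) (hv : ContDiff ℝ 2 v) (amin B A Qb : ℝ) (hamin : 0 < amin)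
    (hell : ∀ (x ξ : Fin d → ℝ), amin * ∑ i, ξ i ^ 2 ≤ ξ ⬝ᵥ ((s x * (s x)ᵀ) *ᵥ ξ))
    (hB : ∀ x j, |b x j| ≤ B) (hA : ∀ x, ∑ j, (s x * (s x)ᵀ) j j ≤ A)
    (hQ0 : ∀ x, 0 ≤ Q x) (hQ : ∀ x, Q x ≤ Qb) (hB0 : 0 ≤ B) (hA0 : 0 ≤ A)
    (hv0 : ∀ x, v x ≤ 0) (x0 : Fin d → ℝ) (hx0 : v x0 = 0)
    (hP : ∀ x, 0 ≤ (∑ j, b x j * pd v j x) + (1/2) * ∑ j, ∑ k, (s x * (s x)ᵀ) j k * pd2 v j k x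
      - Q x * v x) : ∀ x, v x = 0 := by
  intro z
  by_contra hz
  have hz' : v z < 0 := lt_of_le_of_ne (hv0 z) hz
  obtain ⟨δ, hδ⟩ : ∃ δ, δ = -v z / 2 := ⟨_, rfl⟩
  have hδ0 : 0 < δ := by rw [hδ]; linarith
  have hvc : Continuous v := hv.continuous
  obtain ⟨t, ht, hball⟩ : ∃ t > 0, ∀ x, dist x z < t → v x < -δ := by
    have : {x | v x < -δ} ∈ nhds z := (isOpen_lt hvc continuous_const).mem_nhds (by
      show v z < -δ
      rw [hδ]; linarith)
    obtain ⟨t, ht, h⟩ := Metric.mem_nhds_iff.1 this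
    exact ⟨t, ht, fun x hx => h hx⟩
  obtain ⟨ρ, hρ⟩ : ∃ ρ, ρ = (t/2)^2 := ⟨_, rfl⟩
  have hρ0 : 0 < ρ := by rw [hρ]; positivity
  have hNi : ∀ x i, (x i - z i)^2 ≤ NN z x := fun x i =>
    Finset.single_le_sum (f := fun i => (x i - z i)^2) (fun i _ => sq_nonneg _) (Finset.mem_univ i)
  have hin : ∀ x, NN z x ≤ ρ → v x < -δ := by
    intro x hx
    apply hball
    have : dist x z ≤ t/2 := by
      rw [dist_pi_le_iff (by positivity)]
      intro i
      rw [Real.dist_eq]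
      apply abs_le_of_sq_le_sq _ (by positivity)
      calc _ ≤ _ := hNi x i
        _ ≤ _ := by rw [← hρ]; exact hx
    linarith
  have hx0N : ρ < NN z x0 := by
    by_contra h
    have := hin x0 (not_lt.1 h)
    linarith
  -- choose lam
  obtain ⟨lam, hl1, hl2⟩ : ∃ lam : ℝ, 1 ≤ lam ∧ 2*ρ*B + 2*B*d + A + Qb < 2*ρ*amin*lam := by
    have hpos : 0 < 2*ρ*amin := by positivity
    refine ⟨max 1 ((2*ρ*B + 2*B*d + A + Qb)/(2*ρ*amin) + 1), le_max_left _ _, ?_⟩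
    have : (2*ρ*B + 2*B*d + A + Qb)/(2*ρ*amin) < max 1 ((2*ρ*B + 2*B*d + A + Qb)/(2*ρ*amin) + 1) :=
      lt_of_lt_of_le (by linarith) (le_max_right _ _)
    rw [div_lt_iff₀ hpos] at this
    linarith
  have hQb : 0 ≤ Qb := (hQ0 z).trans (hQ z)
  have hPh : ∀ x, ρ ≤ NN z x → 0 < (∑ j, b x j * pd (bar lam z) j x)
      + (1/2) * ∑ j, ∑ k, (s x * (s x)ᵀ) j k * pd2 (bar lam z) j k x - Q x * bar lam z x := by
    intro x hx
    have hbp : 0 < bar lam z x := Real.exp_pos _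
    simp only [pd_bar, pd2_bar]
    have e1 : ∑ j, b x j * (-2 * lam * ((x j - z j) * bar lam z x))
        = bar lam z x * (-2*lam * ∑ j, b x j * (x j - z j)) := by
      simp only [Finset.mul_sum]
      exact Finset.sum_congr rfl fun j _ => by ring
    have e2 : ∑ j, ∑ k, (s x * (s x)ᵀ) j k * ((4 * lam ^ 2 * ((x j - z j) * (x k - z k))
      - 2 * lam * (if j = k then 1 else 0)) * bar lam z x)
        = bar lam z x * (4*lam^2 * ((fun j => x j - z j) ⬝ᵥ ((s x * (s x)ᵀ) *ᵥ (fun j => x j - z j)))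
          - 2*lam * ∑ j, (s x * (s x)ᵀ) j j) := by
      exact bar_alg _ _ _ _
    rw [e1, e2]
    have f1 := hell x (fun j => x j - z j)
    have f1' : amin * NN z x ≤ ((fun j => x j - z j) ⬝ᵥ ((s x * (s x)ᵀ) *ᵥ (fun j => x j - z j))) := f1
    have f2 : ∑ j, b x j * (x j - z j) ≤ B * (d + NN z x) := by
      have : ∑ j, b x j * (x j - z j) ≤ ∑ j : Fin d, B * (1 + (x j - z j)^2) := by
        refine Finset.sum_le_sum fun j _ => ?_
        calc b x j * (x j - z j) ≤ |b x j * (x j - z j)| := le_abs_self _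
          _ = |b x j| * |x j - z j| := abs_mul _ _
          _ ≤ B * (1 + (x j - z j)^2) := by
            apply mul_le_mul (hB x j) _ (abs_nonneg _) hB0
            rw [← sq_abs]
            nlinarith [sq_nonneg (|x j - z j| - 1), abs_nonneg (x j - z j)]
      refine this.trans (le_of_eq ?_)
      rw [← Finset.mul_sum, Finset.sum_add_distrib]
      simp [NN]
    have := mul_pos hbp (bar_num hl1 hl2 hρ0 hB0 hQb (Nat.cast_nonneg d) f1' f2 (hA x) (hQ x) hx hA0)
    linarith
  obtain ⟨ε, hε⟩ : ∃ ε, ε = δ/2 := ⟨_, rfl⟩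
  have hε0 : 0 < ε := by rw [hε]; linarith
  let w : (Fin d → ℝ) → ℝ := fun x => v x + ε * bar lam z x
  have hwC : ContDiff ℝ 2 w := hv.add (contDiff_const.mul (bar_contDiff lam z))
  have hNc : Continuous (NN z) := (NN_contDiff z 2).continuous
  obtain ⟨R, hR⟩ : ∃ R, R = NN z x0 + 1 := ⟨_, rfl⟩
  have hK : IsCompact {x | ρ ≤ NN z x ∧ NN z x ≤ R} := by
    apply Metric.isCompact_of_isClosed_isBounded
    · exact (isClosed_le continuous_const hNc).inter (isClosed_le hNc continuous_const)
    · refine (Metric.isBounded_closedBall (x := z) (r := R + 1)).subset fun x hx => ?_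
      rw [Metric.mem_closedBall]
      have hR0 : 0 ≤ R := by linarith
      rw [dist_pi_le_iff (by linarith)]
      intro i
      rw [Real.dist_eq]
      apply abs_le_of_sq_le_sq _ (by linarith)
      have h1 := hNi x i
      have h2 : NN z x ≤ R := hx.2
      nlinarith
  obtain ⟨y, hyK, hymax⟩ := hK.exists_isMaxOn ⟨x0, hx0N.le, by linarith⟩ hwC.continuous.continuousOn
  have hwx0 : w x0 = ε * bar lam z x0 := by simp [w, hx0]
  have hwy : w x0 ≤ w y := hymax ⟨hx0N.le, by linarith⟩
  have hwy0 : 0 < w y := lt_of_lt_of_le (by rw [hwx0]; exact mul_pos hε0 (Real.exp_pos _)) hwy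
  have hb1 : ∀ x, bar lam z x ≤ 1 := fun x => by
    unfold bar
    rw [Real.exp_le_one_iff]
    have : 0 ≤ NN z x := Finset.sum_nonneg fun i _ => sq_nonneg _
    nlinarith
  have hy1 : ρ < NN z y := by
    by_contra h
    have h1 := hin y (not_lt.1 h)
    have h2 := hb1 y
    have : w y = v y + ε * bar lam z y := rfl
    nlinarith
  have hy2 : NN z y < R := by
    by_contra h
    have h1 : bar lam z y < bar lam z x0 := by
      unfold bar
      rw [Real.exp_lt_exp]
      nlinarith
    have h2 : w y = v y + ε * bar lam z y := rfl
    have h3 := hv0 y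
    have h4 := mul_lt_mul_of_pos_left h1 hε0
    linarith
  have hloc : IsLocalMax w y := by
    have hopen : IsOpen {x | ρ < NN z x ∧ NN z x < R} :=
      (isOpen_lt continuous_const hNc).inter (isOpen_lt hNc continuous_const)
    filter_upwards [hopen.mem_nhds ⟨hy1, hy2⟩] with x hx
    exact hymax ⟨hx.1.le, hx.2.le⟩
  have hpw : ∀ j x, pd w j x = pd v j x + ε * pd (bar lam z) j x := by
    intro j x
    have dv : Differentiable ℝ v := hv.differentiable (by norm_num)
    have db : Differentiable ℝ (bar lam z) := (bar_contDiff lam z).differentiable (by norm_num)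
    have : HasFDerivAt w (fderiv ℝ v x + ε • fderiv ℝ (bar lam z) x) x :=
      (dv x).hasFDerivAt.add ((db x).hasFDerivAt.const_mul ε)
    unfold pd
    rw [this.fderiv]
    simp
  have hpw2 : ∀ j k x, pd2 w j k x = pd2 v j k x + ε * pd2 (bar lam z) j k x := by
    intro j k x
    have dv : Differentiable ℝ (fun y => pd v j y) := (pd_C1 hv j).differentiable (by norm_num)
    have db : Differentiable ℝ (fun y => pd (bar lam z) j y) := (pd_C1 (bar_contDiff lam z) j).differentiable (by norm_num)
    have : HasFDerivAt (fun y => pd w j y) (fderiv ℝ (fun y => pd v j y) x + ε • fderiv ℝ (fun y => pd (bar lam z) j y) x) x := by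
      simp only [hpw]
      exact (dv x).hasFDerivAt.add ((db x).hasFDerivAt.const_mul ε)
    unfold pd2
    unfold pd at this ⊢
    rw [this.fderiv]
    simp
  have hw1 : ∀ j, pd w j y = 0 := by
    intro j
    unfold pd
    rw [hloc.fderiv_eq_zero]; simp
  have hw2 := second_test_mat hwC hloc (s y)
  have hPw : 0 < (∑ j, b y j * pd w j y) + (1/2) * ∑ j, ∑ k, (s y * (s y)ᵀ) j k * pd2 w j k y
      - Q y * w y := by
    have h1 := hP y
    have h2 := mul_pos hε0 (hPh y hy1.le)
    have : (∑ j, b y j * pd w j y) + (1/2) * ∑ j, ∑ k, (s y * (s y)ᵀ) j k * pd2 w j k y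
      - Q y * w y = ((∑ j, b y j * pd v j y) + (1/2) * ∑ j, ∑ k, (s y * (s y)ᵀ) j k * pd2 v j k y
      - Q y * v y) + ε * ((∑ j, b y j * pd (bar lam z) j y)
      + (1/2) * ∑ j, ∑ k, (s y * (s y)ᵀ) j k * pd2 (bar lam z) j k y - Q y * bar lam z y) := by
      simp only [hpw, hpw2, mul_add, Finset.sum_add_distrib, w]
      have k1 : ∑ j, b y j * (ε * pd (bar lam z) j y) = ε * ∑ j, b y j * pd (bar lam z) j y := by
        rw [Finset.mul_sum]; exact Finset.sum_congr rfl fun j _ => by ring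
      have k2 : ∑ j, ∑ k, (s y * (s y)ᵀ) j k * (ε * pd2 (bar lam z) j k y)
          = ε * ∑ j, ∑ k, (s y * (s y)ᵀ) j k * pd2 (bar lam z) j k y := by
        simp only [Finset.mul_sum]
        exact Finset.sum_congr rfl fun j _ => Finset.sum_congr rfl fun k _ => by ring
      rw [k1, k2]; ring
    rw [this]
    linarith
  simp only [hw1, mul_zero, Finset.sum_const_zero] at hPw
  have := mul_nonneg (hQ0 y) hwy0.le
  linarith

lemma per_max {d : ℕ} {f : (Fin d → ℝ) → ℝ} (hf : Continuous f) (hp : Per f) :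
    ∃ x0, ∀ x, f x ≤ f x0 := by
  have hK : IsCompact (Set.Icc (0 : Fin d → ℝ) 1) := isCompact_Icc
  obtain ⟨x0, _, hmax⟩ := hK.exists_isMaxOn ⟨0, by simp⟩ hf.continuousOn
  refine ⟨x0, fun x => ?_⟩
  have h1 := hp x (fun i => -⌊x i⌋)
  rw [← h1]
  apply hmax
  constructor
  · intro i
    simp only [Pi.add_apply, Pi.zero_apply]
    push_cast
    linarith [Int.floor_le (x i)]
  · intro i
    simp only [Pi.add_apply, Pi.one_apply]
    push_cast
    linarith [Int.lt_floor_add_one (x i)]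

lemma strong_max {d r m : ℕ} (hm : 0 < m)
    (b : (Fin d → ℝ) → Fin m → Fin d → ℝ)
    (σ : (Fin d → ℝ) → Fin m → Matrix (Fin d) (Fin r) ℝ)
    (q : Fin m → Fin m → (Fin d → ℝ) → ℝ)
    (amin qbar : ℝ) (hamin : 0 < amin)
    (hb : ∀ α j, Continuous fun x => b x α j)
    (ha : ∀ α i j, Continuous fun x => diffMat σ x α i j)
    (hell : ∀ (x ξ : Fin d → ℝ) (α : Fin m),
      amin * ∑ i, ξ i ^ 2 ≤ ξ ⬝ᵥ (diffMat σ x α *ᵥ ξ))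
    (hq_nonneg : ∀ α β, α ≠ β → ∀ x, 0 ≤ q α β x)
    (hq_bdd : ∀ α β, α ≠ β → ∀ x, q α β x ≤ qbar)
    (hq_irred : ∀ (x : Fin d → ℝ) (B : Set (Fin m)), B.Nonempty → Bᶜ.Nonempty →
      ∃ α ∈ B, ∃ β ∈ Bᶜ, q α β x ≠ 0)
    (hb_per : ∀ α j, Per fun x => b x α j)
    (ha_per : ∀ α i j, Per fun x => diffMat σ x α i j)
    (u : (Fin d → ℝ) → Fin m → ℝ) (hu : ∀ α, ContDiff ℝ 2 fun x => u x α)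
    (hup : ∀ α, Per fun x => u x α) (hgen : ∀ x α, gen b (diffMat σ) q u x α = 0) :
    ∃ c, ∀ x α, u x α = c := by
  haveI : Nonempty (Fin m) := ⟨⟨0, hm⟩⟩
  choose y hy using fun α => per_max (hu α).continuous (hup α)
  obtain ⟨α0, hα0⟩ := Finite.exists_max (fun α => u (y α) α)
  obtain ⟨K, hK⟩ : ∃ K, K = u (y α0) α0 := ⟨_, rfl⟩
  have hle : ∀ x α, u x α ≤ K := fun x α => (hy α x).trans (by rw [hK]; exact hα0 α)
  -- scalar step
  have step : ∀ α, (∃ x0, u x0 α = K) → ∀ x, u x α = K := by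
    intro α ⟨x0, hx0⟩
    obtain ⟨xb, hxb⟩ := per_max (f := fun x => ∑ j, |b x α j|)
      (continuous_finsetSum _ fun j _ => (hb α j).abs)
      (fun x ν => Finset.sum_congr rfl fun j _ => by rw [show b (x + fun i => (ν i : ℝ)) α j = b x α j from hb_per α j x ν])
    obtain ⟨xa, hxa⟩ := per_max (f := fun x => ∑ j, diffMat σ x α j j)
      (continuous_finsetSum _ fun j _ => (ha α j j))
      (fun x ν => Finset.sum_congr rfl fun j _ => ha_per α j j x ν)
    have dv : ContDiff ℝ 2 fun x => u x α - K := (hu α).sub contDiff_const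
    have p1 : ∀ j x, pd (fun x => u x α - K) j x = pd (fun x => u x α) j x := by
      intro j x; unfold pd; rw [fderiv_sub_const]
    have p2 : ∀ j k x, pd2 (fun x => u x α - K) j k x = pd2 (fun x => u x α) j k x := by
      intro j k x; unfold pd2; simp only [p1]
    have := core_max (fun x => b x α) (fun x => σ x α)
      (fun x => ∑ β ∈ Finset.univ.filter (fun β => β ≠ α), q α β x) (fun x => u x α - K)
      dv amin (∑ j, |b xb α j|) |∑ j, diffMat σ xa α j j|
      (∑ β ∈ Finset.univ.filter (fun β => β ≠ α), qbar) hamin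
      (fun x ξ => hell x ξ α)
      (fun x j => (Finset.single_le_sum (f := fun j => |b x α j|) (fun _ _ => abs_nonneg _)
        (Finset.mem_univ j)).trans (hxb x))
      (fun x => (hxa x).trans (le_abs_self _))
      (fun x => Finset.sum_nonneg fun β hβ => hq_nonneg α β (Finset.mem_filter.1 hβ).2.symm x)
      (fun x => Finset.sum_le_sum fun β hβ => hq_bdd α β (Finset.mem_filter.1 hβ).2.symm x)
      (Finset.sum_nonneg fun _ _ => abs_nonneg _) (abs_nonneg _)
      (fun x => by linarith [hle x α]) x0 (by linarith) ?_
    · intro x; linarith [this x]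
    · intro x
      simp only [p1, p2]
      have h := hgen x α
      unfold gen jumpOp at h
      have h2 : ∑ β ∈ Finset.univ.filter (fun β => β ≠ α), q α β x * (u x β - u x α)
          ≤ ∑ β ∈ Finset.univ.filter (fun β => β ≠ α), q α β x * (K - u x α) := by
        refine Finset.sum_le_sum fun β hβ => ?_
        exact mul_le_mul_of_nonneg_left (by linarith [hle x β])
          (hq_nonneg α β (Finset.mem_filter.1 hβ).2.symm x)
      rw [← Finset.sum_mul] at h2
      have h3 : ∑ j, ∑ k, diffMat σ x α j k * pd2 (fun y => u y α) j k x
        = ∑ j, ∑ k, (σ x α * (σ x α)ᵀ) j k * pd2 (fun y => u y α) j k x := rfl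
      rw [h3] at h
      linarith
  refine ⟨K, ?_⟩
  by_contra hne
  push Not at hne
  obtain ⟨x1, α1, h1⟩ := hne
  obtain ⟨α, hα, β, hβ, hqne⟩ := hq_irred 0 {α | ∀ x, u x α = K} ⟨α0, step α0 ⟨y α0, hK.symm⟩⟩
    ⟨α1, fun h => h1 (h x1)⟩
  have hα' : ∀ x, u x α = K := hα
  have hβ' : ∀ x, u x β ≠ K := fun x h => hβ (step β ⟨x, h⟩)
  have hαβ : α ≠ β := fun h => hβ' 0 (h ▸ hα' 0)
  have hg := hgen 0 α
  have hconst : (fun y => u y α) = fun _ => K := funext hα'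
  unfold gen jumpOp at hg
  rw [hconst] at hg
  have z1 : ∀ j x, pd (fun _ : Fin d → ℝ => K) j x = 0 := by intro j x; simp [pd]
  have z2 : ∀ j k x, pd2 (fun _ : Fin d → ℝ => K) j k x = 0 := by
    intro j k x; unfold pd2; simp only [z1]; simp [pd]
  simp only [z1, z2, mul_zero, Finset.sum_const_zero, zero_add, hα'] at hg
  have hnp : ∀ β ∈ Finset.univ.filter (fun β => β ≠ α), q α β 0 * (u 0 β - K) ≤ 0 := fun β hβ =>
    mul_nonpos_of_nonneg_of_nonpos (hq_nonneg α β (Finset.mem_filter.1 hβ).2.symm 0) (by linarith [hle 0 β])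
  have := (Finset.sum_eq_zero_iff_of_nonpos hnp).1 hg β (by simp [hαβ.symm])
  rcases mul_eq_zero.1 this with h | h
  · exact hqne h
  · exact hβ' 0 (by linarith)

/-- Fourier series -/
def FS {d : ℕ} (c : (Fin d → ℤ) → ℂ) (x : Fin d → ℝ) : ℂ := ∑' k, c k * ee k x

def Dc {d : ℕ} (j : Fin d) (c : (Fin d → ℤ) → ℂ) : (Fin d → ℤ) → ℂ :=
  fun k => (2 * Real.pi * Complex.I * (k j : ℂ)) * c k

def WS {d : ℕ} (n : ℕ) (c : (Fin d → ℤ) → ℂ) : Prop := Summable fun k => jb k ^ n * ‖c k‖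

lemma WS.zero_summable {d : ℕ} {n : ℕ} {c : (Fin d → ℤ) → ℂ} (h : WS n c) : Summable fun k => ‖c k‖ := by
  refine Summable.of_nonneg_of_le (fun k => norm_nonneg _) (fun k => ?_) h
  exact le_mul_of_one_le_left (norm_nonneg _) (one_le_pow₀ (jb_one_le k))

lemma Dc_norm {d : ℕ} (j : Fin d) (k : Fin d → ℤ) :
    ‖(2 * Real.pi * Complex.I * (k j : ℂ))‖ ≤ 2 * Real.pi * jb k := by
  simp only [norm_mul, Complex.norm_I, mul_one, Complex.norm_real, Complex.norm_intCast,
    RCLike.norm_ofNat, Real.norm_eq_abs, abs_of_pos Real.pi_pos]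
  have h1 := abs_le_norm k j
  have : |(k j : ℝ)| ≤ jb k := by unfold jb; linarith
  have := Real.pi_pos
  gcongr

lemma WS.Dc {d : ℕ} {n : ℕ} {c : (Fin d → ℤ) → ℂ} (h : WS (n+1) c) (j : Fin d) : WS n (Dc j c) := by
  have h' : Summable fun k => (2 * Real.pi) * (jb k ^ (n+1) * ‖c k‖) := Summable.mul_left _ h
  refine Summable.of_nonneg_of_le (fun k => by have := jb_pos k; positivity) (fun k => ?_) h'
  unfold _root_.Dc
  rw [norm_mul]
  have := Dc_norm j k
  have hp := jb_pos k
  calc jb k ^ n * (‖(2 * Real.pi * Complex.I * (k j : ℂ))‖ * ‖c k‖)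
      ≤ jb k ^ n * ((2 * Real.pi * jb k) * ‖c k‖) := by gcongr
    _ = _ := by ring

lemma FS_hasSum {d : ℕ} {c : (Fin d → ℤ) → ℂ} (h : Summable fun k => ‖c k‖) (x : Fin d → ℝ) :
    HasSum (fun k => c k * ee k x) (FS c x) := by
  refine Summable.hasSum (Summable.of_norm ?_)
  simpa [ee_norm] using h

lemma FS_continuous {d : ℕ} {c : (Fin d → ℤ) → ℂ} (h : Summable fun k => ‖c k‖) :
    Continuous (FS c) := by
  refine continuous_tsum (fun k => continuous_const.mul (ee_continuous k)) h (fun k x => ?_)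
  simp [ee_norm]

lemma FS_per {d : ℕ} (c : (Fin d → ℤ) → ℂ) : PerE (FS c) := by
  intro x ν
  unfold FS
  refine tsum_congr fun k => ?_
  rw [ee_per k x ν]

def Pj {d : ℕ} (j : Fin d) : (Fin d → ℝ) →L[ℝ] ℂ :=
  Complex.ofRealCLM.comp (ContinuousLinearMap.proj j)

lemma eL_norm {d : ℕ} (k : Fin d → ℤ) : ‖eL k‖ ≤ (2 * Real.pi * ∑ j : Fin d, ‖Pj j‖) * jb k := by
  unfold eL
  refine (norm_sum_le _ _).trans ?_
  rw [Finset.mul_sum, Finset.sum_mul]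
  refine Finset.sum_le_sum fun j _ => ?_
  rw [norm_smul]
  have := Dc_norm j k
  calc _ ≤ (2 * Real.pi * jb k) * ‖Pj j‖ := mul_le_mul_of_nonneg_right this (norm_nonneg _)
    _ = _ := by ring

lemma FS_hasFDerivAt {d : ℕ} {c : (Fin d → ℤ) → ℂ} (h : WS 1 c) (x : Fin d → ℝ) :
    HasFDerivAt (FS c) (∑ j, FS (Dc j c) x • Pj j) x := by
  have h1 := hasFDerivAt_tsum (𝕜 := ℝ) (f := fun k x => c k * ee k x) (f' := fun k x => c k • (ee k x • eL k))
    (u := fun k => (2 * Real.pi * ∑ j : Fin d, ‖Pj j‖) * (jb k ^ 1 * ‖c k‖)) (x₀ := x)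
    (Summable.mul_left _ h) (fun k x => (ee_hasFDerivAt k x).const_mul (c k))
    (fun k x => by
      rw [norm_smul, norm_smul, ee_norm, one_mul]
      calc _ ≤ ‖c k‖ * ((2 * Real.pi * ∑ j : Fin d, ‖Pj j‖) * jb k) :=
            mul_le_mul_of_nonneg_left (eL_norm k) (norm_nonneg _)
        _ = _ := by ring)
    (FS_hasSum h.zero_summable x).summable x
  have h2 : HasSum (fun k => c k • (ee k x • eL k)) (∑ j, FS (Dc j c) x • (Pj j : (Fin d → ℝ) →L[ℝ] ℂ)) := by
    have := hasSum_sum (s := Finset.univ) (fun (j : Fin d) _ => (FS_hasSum (c := Dc j c) (h.Dc j).zero_summable x).smul_const (Pj j))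
    convert this using 1
    funext k
    unfold eL Dc
    simp only [Finset.smul_sum, smul_smul]
    refine Finset.sum_congr rfl fun j _ => ?_
    unfold Pj
    congr 1
    ring
  rw [h2.tsum_eq] at h1
  exact h1

lemma FS_fderiv {d : ℕ} {c : (Fin d → ℤ) → ℂ} (h : WS 1 c) (x : Fin d → ℝ) (j : Fin d) :
    fderiv ℝ (FS c) x (Pi.single j 1) = FS (Dc j c) x := by
  rw [(FS_hasFDerivAt h x).fderiv]
  simp only [_root_.sum_apply, _root_.smul_apply, Pj, ContinuousLinearMap.comp_apply,
    ContinuousLinearMap.proj_apply, Complex.ofRealCLM_apply, smul_eq_mul]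
  rw [Finset.sum_eq_single j]
  · simp
  · intro i _ hij; simp [hij]
  · simp

lemma FS_contDiff {d : ℕ} (n : ℕ) : ∀ {c : (Fin d → ℤ) → ℂ}, WS n c → ContDiff ℝ n (FS c) := by
  induction n with
  | zero => intro c h; exact contDiff_zero.2 (FS_continuous h.zero_summable)
  | succ n ih =>
    intro c h
    have h1 : WS 1 c := by
      refine Summable.of_nonneg_of_le (fun k => by have := jb_pos k; positivity) (fun k => ?_) h
      exact mul_le_mul_of_nonneg_right (pow_le_pow_right₀ (jb_one_le k) (by omega)) (norm_nonneg _)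
    push_cast
    rw [contDiff_succ_iff_hasFDerivAt]
    exact ⟨_, ContDiff.sum fun j _ => (ih (h.Dc j)).smul contDiff_const, FS_hasFDerivAt h1⟩

lemma WS.mono {d : ℕ} {n n' : ℕ} {c : (Fin d → ℤ) → ℂ} (h : WS n c) (hn : n' ≤ n) : WS n' c := by
  refine Summable.of_nonneg_of_le (fun k => by have := jb_pos k; positivity) (fun k => ?_) h
  exact mul_le_mul_of_nonneg_right (pow_le_pow_right₀ (jb_one_le k) hn) (norm_nonneg _)

lemma pd_comp_FS {d : ℕ} (φ : ℂ →L[ℝ] ℝ) {c : (Fin d → ℤ) → ℂ} (h : WS 1 c) (j : Fin d) (x : Fin d → ℝ) :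
    pd (fun x => φ (FS c x)) j x = φ (FS (Dc j c) x) := by
  unfold pd
  have h1 : HasFDerivAt (fun x => φ (FS c x)) (φ.comp (∑ j, FS (Dc j c) x • Pj j)) x :=
    φ.hasFDerivAt.comp x (FS_hasFDerivAt h x)
  rw [h1.fderiv, ContinuousLinearMap.comp_apply, ← (FS_hasFDerivAt h x).fderiv, FS_fderiv h]

lemma pd2_comp_FS {d : ℕ} (φ : ℂ →L[ℝ] ℝ) {c : (Fin d → ℤ) → ℂ} (h : WS 2 c) (j k : Fin d) (x : Fin d → ℝ) :
    pd2 (fun x => φ (FS c x)) j k x = φ (FS (Dc k (Dc j c)) x) := by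
  unfold pd2
  simp only [pd_comp_FS φ (h.mono (by norm_num))]
  exact pd_comp_FS φ (h.Dc j) k x

lemma hat_mul_FS {d : ℕ} {h : (Fin d → ℝ) → ℂ} (hh : Continuous h) {c : (Fin d → ℤ) → ℂ}
    (hc : Summable fun k => ‖c k‖) (k : Fin d → ℤ) :
    HasSum (fun l => hat h (k - l) * c l) (hat (fun x => h x * FS c x) k) := by
  have hnorm : ∀ l, ∫ x in cube d, ‖c l * (h x * ee l x * ee (-k) x)‖ = ‖c l‖ * ∫ x in cube d, ‖h x‖ := by
    intro l
    simp only [norm_mul, ee_norm, mul_one]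
    rw [integral_const_mul]
  have h1 := hasSum_integral_of_summable_integral_norm (μ := volume.restrict (cube d))
    (F := fun l x => c l * (h x * ee l x * ee (-k) x))
    (fun l => cube_integrable (continuous_const.mul ((hh.mul (ee_continuous l)).mul (ee_continuous _))))
    (by simp only [hnorm]; exact hc.mul_right _)
  have h2 : ∀ l, ∫ x in cube d, c l * (h x * ee l x * ee (-k) x) = hat h (k - l) * c l := by
    intro l
    rw [integral_const_mul, ← hat_mul_ee h k l, mul_comm]
    rfl
  simp only [h2] at h1
  have e : hat (fun x => h x * FS c x) k
      = ∫ x in cube d, ∑' l, c l * (h x * ee l x * ee (-k) x) := by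
    unfold hat
    congr 1
    funext x
    have h3 := ((FS_hasSum hc x).mul_left (h x)).mul_right (ee (-k) x)
    rw [← h3.tsum_eq]
    refine tsum_congr fun l => ?_
    ring
  rw [e]
  exact h1

lemma hat_FS {d : ℕ} {c : (Fin d → ℤ) → ℂ} (hc : Summable fun k => ‖c k‖) (k : Fin d → ℤ) :
    hat (FS c) k = c k := by
  have h1 := hat_mul_FS (h := fun _ => (1:ℂ)) continuous_const hc k
  simp only [one_mul, hat_one] at h1
  have h2 : HasSum (fun l => (if k - l = 0 then (1:ℂ) else 0) * c l) (c k) := by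
    convert hasSum_ite_eq k (c k) using 1
    funext l
    by_cases hl : l = k
    · subst hl; simp
    · have : k - l ≠ 0 := fun h => hl (sub_eq_zero.1 h).symm
      simp [hl, this]
  exact h1.unique h2

lemma hasSum_prod_fin {E : Type*} [NormedAddCommGroup E] {ι : Type*} {m : ℕ} {F : ι × Fin m → E} {s : Fin m → E}
    (h : ∀ β, HasSum (fun l => F (l, β)) (s β)) : HasSum F (∑ β, s β) := by
  have h1 : ∀ β, HasSum (fun p : ι × Fin m => if p.2 = β then F p else 0) (s β) := by
    intro β
    have hi : Function.Injective (fun l : ι => (l, β)) := fun a b hab => (Prod.mk.inj hab).1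
    rw [← hi.hasSum_iff]
    · convert h β using 1
      funext l; simp
    · rintro ⟨l, γ⟩ hx
      have : γ ≠ β := fun hg => hx ⟨l, by rw [hg]⟩
      simp [this]
  have h2 := hasSum_sum (s := Finset.univ) (fun β _ => h1 β)
  convert h2 using 1
  funext p
  simp

lemma trig_form {d : ℕ} {ι : Type*} (F : Finset ι) (κ : ι → Fin d → ℤ) (y z : ι → ℂ)
    {h : (Fin d → ℝ) → ℂ} (hh : Continuous h) :
    ∫ x in cube d, (starRingEnd ℂ) (∑ p ∈ F, y p * ee (κ p) x) * (h x * ∑ r ∈ F, z r * ee (κ r) x)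
      = ∑ p ∈ F, ∑ r ∈ F, (starRingEnd ℂ) (y p) * (hat h (κ p - κ r) * z r) := by
  have e : ∀ x, (starRingEnd ℂ) (∑ p ∈ F, y p * ee (κ p) x) * (h x * ∑ r ∈ F, z r * ee (κ r) x)
      = ∑ p ∈ F, ∑ r ∈ F, ((starRingEnd ℂ) (y p) * z r) * (h x * ee (κ r) x * ee (-(κ p)) x) := by
    intro x
    rw [map_sum, Finset.sum_mul]
    refine Finset.sum_congr rfl fun p _ => ?_
    rw [Finset.mul_sum, Finset.mul_sum]
    refine Finset.sum_congr rfl fun r _ => ?_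
    rw [map_mul, ee_conj]; ring
  simp only [e]
  have hc : ∀ p r, Continuous fun x => ((starRingEnd ℂ) (y p) * z r) * (h x * ee (κ r) x * ee (-(κ p)) x) :=
    fun p r => continuous_const.mul ((hh.mul (ee_continuous _)).mul (ee_continuous _))
  rw [integral_finsetSum _ (fun p _ => cube_integrable (continuous_finsetSum _ fun r _ => hc p r))]
  refine Finset.sum_congr rfl fun p _ => ?_
  rw [integral_finsetSum _ (fun r _ => cube_integrable (hc p r))]
  refine Finset.sum_congr rfl fun r _ => ?_
  rw [integral_const_mul, ← hat_mul_ee]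
  unfold hat
  ring

lemma herm_form {d : ℕ} {amin : ℝ} (A : Matrix (Fin d) (Fin d) ℝ)
    (hell : ∀ ξ : Fin d → ℝ, amin * ∑ i, ξ i ^ 2 ≤ ξ ⬝ᵥ (A *ᵥ ξ)) (v : Fin d → ℂ) :
    amin * (∑ i, (starRingEnd ℂ) (v i) * (1 * v i)).re
      ≤ (∑ i, ∑ j, (starRingEnd ℂ) (v i) * ((A i j : ℂ) * v j)).re := by
  have h1 := hell (fun i => (v i).re)
  have h2 := hell (fun i => (v i).im)
  have e1 : (∑ i, (starRingEnd ℂ) (v i) * (1 * v i)).re = ∑ i, (v i).re^2 + ∑ i, (v i).im^2 := by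
    rw [Complex.re_sum, ← Finset.sum_add_distrib]
    refine Finset.sum_congr rfl fun i _ => ?_
    simp; ring
  have e2 : (∑ i, ∑ j, (starRingEnd ℂ) (v i) * ((A i j : ℂ) * v j)).re
      = (fun i => (v i).re) ⬝ᵥ (A *ᵥ (fun i => (v i).re)) + (fun i => (v i).im) ⬝ᵥ (A *ᵥ (fun i => (v i).im)) := by
    simp only [dotProduct, mulVec, Finset.mul_sum]
    rw [Complex.re_sum, ← Finset.sum_add_distrib]
    refine Finset.sum_congr rfl fun i _ => ?_
    rw [Complex.re_sum, ← Finset.sum_add_distrib]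
    refine Finset.sum_congr rfl fun j _ => ?_
    simp
  rw [e1, e2]
  linarith

lemma coer_a {d : ℕ} {ι : Type*} (F : Finset ι) (κ : ι → Fin d → ℤ)
    (hκ : ∀ p ∈ F, ∀ r ∈ F, κ p = κ r → p = r) (z : ι → Fin d → ℂ)
    (a : (Fin d → ℝ) → Matrix (Fin d) (Fin d) ℝ) (ha : ∀ i j, Continuous fun x => a x i j)
    {amin : ℝ} (hell : ∀ x, ∀ ξ : Fin d → ℝ, amin * ∑ i, ξ i ^ 2 ≤ ξ ⬝ᵥ (a x *ᵥ ξ)) :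
    amin * ∑ p ∈ F, ∑ i, ‖z p i‖ ^ 2
      ≤ (∑ i, ∑ j, ∑ p ∈ F, ∑ r ∈ F, (starRingEnd ℂ) (z p i) *
          (hat (fun x => (a x i j : ℂ)) (κ p - κ r) * z r j)).re := by
  let V : Fin d → (Fin d → ℝ) → ℂ := fun i x => ∑ r ∈ F, z r i * ee (κ r) x
  have hVc : ∀ i, Continuous (V i) := fun i => continuous_finsetSum _ fun r _ =>
    continuous_const.mul (ee_continuous _)
  have hac : ∀ i j, Continuous fun x => (a x i j : ℂ) := fun i j => Complex.continuous_ofReal.comp (ha i j)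
  have hc1 : ∀ i j, Continuous fun x => (starRingEnd ℂ) (V i x) * ((a x i j : ℂ) * V j x) := fun i j =>
    (Complex.continuous_conj.comp (hVc i)).mul ((hac i j).mul (hVc j))
  have hc2 : ∀ i, Continuous fun x => (starRingEnd ℂ) (V i x) * ((1 : ℂ) * V i x) := fun i =>
    (Complex.continuous_conj.comp (hVc i)).mul (continuous_const.mul (hVc i))
  have hC1 : Continuous fun x => ∑ i, ∑ j, (starRingEnd ℂ) (V i x) * ((a x i j : ℂ) * V j x) :=
    continuous_finsetSum _ fun i _ => continuous_finsetSum _ fun j _ => hc1 i j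
  have hC2 : Continuous fun x => ∑ i, (starRingEnd ℂ) (V i x) * ((1 : ℂ) * V i x) :=
    continuous_finsetSum _ fun i _ => hc2 i
  have I1 : ∫ x in cube d, ∑ i, ∑ j, (starRingEnd ℂ) (V i x) * ((a x i j : ℂ) * V j x)
      = ∑ i, ∑ j, ∑ p ∈ F, ∑ r ∈ F, (starRingEnd ℂ) (z p i) *
          (hat (fun x => (a x i j : ℂ)) (κ p - κ r) * z r j) := by
    rw [integral_finsetSum _ (fun i _ => cube_integrable (continuous_finsetSum _ fun j _ => hc1 i j))]
    refine Finset.sum_congr rfl fun i _ => ?_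
    rw [integral_finsetSum _ (fun j _ => cube_integrable (hc1 i j))]
    refine Finset.sum_congr rfl fun j _ => ?_
    exact trig_form F κ (fun p => z p i) (fun p => z p j) (hac i j)
  have I2 : ∫ x in cube d, ∑ i, (starRingEnd ℂ) (V i x) * ((1 : ℂ) * V i x)
      = ((∑ p ∈ F, ∑ i, ‖z p i‖ ^ 2 : ℝ) : ℂ) := by
    rw [integral_finsetSum _ (fun i _ => cube_integrable (hc2 i)), Finset.sum_comm]
    push_cast
    refine Finset.sum_congr rfl fun i _ => ?_
    rw [trig_form F κ (fun p => z p i) (fun p => z p i) (h := fun _ => 1) continuous_const]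
    refine Finset.sum_congr rfl fun p hp => ?_
    rw [Finset.sum_eq_single p]
    · rw [hat_one]; simp [Complex.conj_mul']
    · intro r hr hrp
      rw [hat_one, if_neg]
      · simp
      · intro h0
        exact hrp (hκ p hp r hr (sub_eq_zero.1 h0)).symm
    · intro h; exact absurd hp h
  have hIneq : amin * (∫ x in cube d, ∑ i, (starRingEnd ℂ) (V i x) * ((1 : ℂ) * V i x)).re
      ≤ (∫ x in cube d, ∑ i, ∑ j, (starRingEnd ℂ) (V i x) * ((a x i j : ℂ) * V j x)).re := by
    have r1 := integral_re (𝕜 := ℂ) (cube_integrable hC1)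
    have r2 := integral_re (𝕜 := ℂ) (cube_integrable hC2)
    simp only [RCLike.re_to_complex] at r1 r2
    rw [← r1, ← r2, ← integral_const_mul]
    apply integral_mono
    · exact cube_integrable (continuous_const.mul (Complex.continuous_re.comp hC2))
    · exact cube_integrable (Complex.continuous_re.comp hC1)
    · intro x
      exact herm_form (a x) (hell x) (fun i => V i x)
  rw [I1, I2, Complex.ofReal_re] at hIneq
  exact hIneq

/-- the coercive part of the kernel -/
def KAk {d m : ℕ} (ah : Fin m → Fin d → Fin d → (Fin d → ℤ) → ℂ) (c : ℝ)
    (p r : (Fin d → ℤ) × Fin m) : ℂ :=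
  if p.2 = r.2 then
    ((2 * Real.pi ^ 2 : ℝ) : ℂ) * ∑ i, ∑ j, ah p.2 i j (p.1 - r.1) *
      (((p.1 i : ℝ) / jb p.1 * ((r.1 j : ℝ) / jb r.1) : ℝ) : ℂ)
    + (if p.1 = r.1 then ((2 * c / jb p.1 : ℝ) : ℂ) else 0)
  else 0

lemma jb_sq_le {d : ℕ} (k : Fin d → ℤ) : 1 ≤ ∑ i, ((k i : ℝ) / jb k) ^ 2 + 2 / jb k := by
  have hp := jb_pos k
  have h1 : ‖k‖ ^ 2 ≤ ∑ i, (k i : ℝ) ^ 2 := by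
    rcases isEmpty_or_nonempty (Fin d) with h | h
    · have : k = 0 := Subsingleton.elim _ _
      subst this
      simp
    · obtain ⟨i, hi⟩ := Finite.exists_max (fun i => ‖k i‖)
      have : ‖k‖ ≤ ‖k i‖ := (pi_norm_le_iff_of_nonneg (norm_nonneg _)).2 hi
      calc ‖k‖ ^ 2 ≤ ‖k i‖ ^ 2 := by gcongr
        _ = (k i : ℝ) ^ 2 := by rw [Int.norm_eq_abs, sq_abs]
        _ ≤ _ := Finset.single_le_sum (f := fun i => (k i : ℝ)^2) (fun _ _ => sq_nonneg _) (Finset.mem_univ i)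
  simp only [div_pow]
  rw [← Finset.sum_div]
  have h2 : ‖k‖ = jb k - 1 := by unfold jb; ring
  rw [h2] at h1
  rw [← sub_nonneg]
  have : (∑ i, (k i : ℝ) ^ 2) / jb k ^ 2 + 2 / jb k - 1
      = (∑ i, (k i : ℝ) ^ 2 + 2 * jb k - jb k ^ 2) / jb k ^ 2 := by field_simp
  rw [this]
  apply div_nonneg _ (by positivity)
  nlinarith

lemma coer_KA {d m : ℕ} (a : (Fin d → ℝ) → Fin m → Matrix (Fin d) (Fin d) ℝ)
    (ha : ∀ α i j, Continuous fun x => a x α i j)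
    {amin : ℝ} (hamin : 0 < amin)
    (hell : ∀ x, ∀ ξ : Fin d → ℝ, ∀ α, amin * ∑ i, ξ i ^ 2 ≤ ξ ⬝ᵥ (a x α *ᵥ ξ))
    (F : Finset ((Fin d → ℤ) × Fin m)) (w : (Fin d → ℤ) × Fin m → ℂ) :
    (2 * Real.pi ^ 2 * amin) * ∑ p ∈ F, ‖w p‖ ^ 2 ≤ (∑ p ∈ F, ∑ r ∈ F, (starRingEnd ℂ) (w p) *
      (KAk (fun α i j => hat (fun x => (a x α i j : ℂ))) (2 * Real.pi ^ 2 * amin) p r * w r)).re := by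
  obtain ⟨c, hc⟩ : ∃ c, c = 2 * Real.pi ^ 2 * amin := ⟨_, rfl⟩
  have hc0 : 0 < c := by rw [hc]; have := Real.pi_pos; positivity
  let Fa : Fin m → Finset ((Fin d → ℤ) × Fin m) := fun α => F.filter (fun p => p.2 = α)
  let z : (Fin d → ℤ) × Fin m → Fin d → ℂ := fun p i => (((p.1 i : ℝ) / jb p.1 : ℝ) : ℂ) * w p
  have main : ∑ p ∈ F, ∑ r ∈ F, (starRingEnd ℂ) (w p) *
      (KAk (fun α i j => hat (fun x => (a x α i j : ℂ))) c p r * w r)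
      = ((2 * Real.pi ^ 2 : ℝ) : ℂ) * ∑ α, (∑ i, ∑ j, ∑ p ∈ Fa α, ∑ r ∈ Fa α, (starRingEnd ℂ) (z p i) *
          (hat (fun x => (a x α i j : ℂ)) (p.1 - r.1) * z r j))
        + ((∑ p ∈ F, 2 * c / jb p.1 * ‖w p‖^2 : ℝ) : ℂ) := by
    have split : ∀ p ∈ F, ∑ r ∈ F, (starRingEnd ℂ) (w p) *
      (KAk (fun α i j => hat (fun x => (a x α i j : ℂ))) c p r * w r)
      = (∑ r ∈ Fa p.2, ((2 * Real.pi ^ 2 : ℝ) : ℂ) * ∑ i, ∑ j, (starRingEnd ℂ) (z p i) *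
          (hat (fun x => (a x p.2 i j : ℂ)) (p.1 - r.1) * z r j)) + ((2 * c / jb p.1 * ‖w p‖^2 : ℝ) : ℂ) := by
      intro p hp
      have e1 : ((2 * c / jb p.1 * ‖w p‖^2 : ℝ) : ℂ) = ∑ r ∈ F, if r = p then ((2 * c / jb p.1 * ‖w p‖^2 : ℝ) : ℂ) else 0 := by
        rw [Finset.sum_ite_eq']; simp [hp]
      rw [e1, Finset.sum_filter, ← Finset.sum_add_distrib]
      refine Finset.sum_congr rfl fun r _ => ?_
      unfold KAk
      by_cases h : p.2 = r.2
      · rw [if_pos h, if_pos h.symm]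
        have e2 : (∑ i, ∑ j, (starRingEnd ℂ) (z p i) * (hat (fun x => (a x p.2 i j : ℂ)) (p.1 - r.1) * z r j))
            = (starRingEnd ℂ) (w p) * ((∑ i, ∑ j, hat (fun x => (a x p.2 i j : ℂ)) (p.1 - r.1) *
            (((p.1 i : ℝ) / jb p.1 * ((r.1 j : ℝ) / jb r.1) : ℝ) : ℂ)) * w r) := by
          simp only [Finset.mul_sum, Finset.sum_mul]
          refine Finset.sum_congr rfl fun i _ => Finset.sum_congr rfl fun j _ => ?_
          simp only [z, map_mul, Complex.conj_ofReal]
          push_cast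
          ring
        rw [e2]
        by_cases h1 : p.1 = r.1
        · have hrp : r = p := (Prod.ext h1 h).symm
          rw [if_pos h1, if_pos hrp, hrp, mul_comm (2 * c / jb p.1) _]
          push_cast
          rw [← Complex.conj_mul']
          ring
        · have hrp : r ≠ p := fun hh => h1 (by rw [hh])
          rw [if_neg h1, if_neg hrp]
          ring
      · have hrp : r ≠ p := fun hh => h (by rw [hh])
        rw [if_neg h, if_neg (Ne.symm h), if_neg hrp]
        simp
    rw [Finset.sum_congr rfl split, Finset.sum_add_distrib]
    congr 1
    · rw [← Finset.sum_fiberwise F (fun p => p.2), Finset.mul_sum]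
      refine Finset.sum_congr rfl fun α _ => ?_
      have : ∀ p ∈ F.filter (fun p => p.2 = α), ∑ r ∈ Fa p.2, ((2 * Real.pi ^ 2 : ℝ) : ℂ) * ∑ i, ∑ j, (starRingEnd ℂ) (z p i) *
          (hat (fun x => (a x p.2 i j : ℂ)) (p.1 - r.1) * z r j) = ∑ r ∈ Fa α, ((2 * Real.pi ^ 2 : ℝ) : ℂ) * ∑ i, ∑ j, (starRingEnd ℂ) (z p i) *
          (hat (fun x => (a x α i j : ℂ)) (p.1 - r.1) * z r j) := by
        intro p hp
        rw [(Finset.mem_filter.1 hp).2]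
      rw [Finset.sum_congr rfl this]
      simp only [← Finset.mul_sum]
      congr 1
      have s1 : ∀ p, ∑ r ∈ Fa α, ∑ i, ∑ j, (starRingEnd ℂ) (z p i) * (hat (fun x => (a x α i j : ℂ)) (p.1 - r.1) * z r j)
          = ∑ i, ∑ j, ∑ r ∈ Fa α, (starRingEnd ℂ) (z p i) * (hat (fun x => (a x α i j : ℂ)) (p.1 - r.1) * z r j) := by
        intro p
        rw [Finset.sum_comm]
        refine Finset.sum_congr rfl fun i _ => ?_
        rw [Finset.sum_comm]
      have s0 : ∀ p r, ∑ i, ∑ j, (starRingEnd ℂ) (z p i) * (hat (fun x => (a x α i j : ℂ)) (p.1 - r.1) * z r j)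
        = ∑ i, (starRingEnd ℂ) (z p i) * ∑ j, (hat (fun x => (a x α i j : ℂ)) (p.1 - r.1) * z r j) := by
        intro p r; simp only [Finset.mul_sum]
      simp only [← s0, s1]
      rw [Finset.sum_comm]
      refine Finset.sum_congr rfl fun i _ => ?_
      rw [Finset.sum_comm]
      refine Finset.sum_congr rfl fun j _ => ?_
      simp only [Fa, Finset.mul_sum]
    · push_cast; rfl
  rw [← hc, main, Complex.add_re, Complex.ofReal_re, Complex.re_ofReal_mul, Complex.re_sum]
  have hA : ∀ α, amin * ∑ p ∈ Fa α, ∑ i, ‖z p i‖ ^ 2 ≤ (∑ i, ∑ j, ∑ p ∈ Fa α, ∑ r ∈ Fa α, (starRingEnd ℂ) (z p i) *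
          (hat (fun x => (a x α i j : ℂ)) (p.1 - r.1) * z r j)).re := by
    intro α
    exact coer_a (Fa α) (fun p => p.1) (fun p hp r hr h => Prod.ext h
      (((Finset.mem_filter.1 hp).2).trans (Finset.mem_filter.1 hr).2.symm)) z (fun x => a x α) (ha α)
      (fun x ξ => hell x ξ α)
  have hsum := Finset.sum_le_sum (fun α (_ : α ∈ Finset.univ) => hA α)
  rw [← Finset.mul_sum, Finset.sum_fiberwise F (fun p => p.2)] at hsum
  have hpi : (0:ℝ) ≤ 2 * Real.pi ^ 2 := by positivity
  have h3 := mul_le_mul_of_nonneg_left hsum hpi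
  have h4 : c * ∑ p ∈ F, ‖w p‖ ^ 2 ≤ 2 * Real.pi ^ 2 * (amin * ∑ p ∈ F, ∑ i, ‖z p i‖ ^ 2)
      + ∑ p ∈ F, 2 * c / jb p.1 * ‖w p‖^2 := by
    have e : 2 * Real.pi ^ 2 * (amin * ∑ p ∈ F, ∑ i, ‖z p i‖ ^ 2) = ∑ p ∈ F, c * ∑ i, ‖z p i‖ ^ 2 := by
      rw [← Finset.mul_sum, hc]; ring
    rw [e, ← Finset.sum_add_distrib, Finset.mul_sum]
    refine Finset.sum_le_sum fun p _ => ?_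
    have e2 : ∑ i, ‖z p i‖ ^ 2 = (∑ i, ((p.1 i : ℝ) / jb p.1) ^ 2) * ‖w p‖ ^ 2 := by
      rw [Finset.sum_mul]
      refine Finset.sum_congr rfl fun i _ => ?_
      simp only [z, norm_mul, Complex.norm_real, Real.norm_eq_abs, mul_pow, sq_abs]
    rw [e2]
    have h5 := mul_le_mul_of_nonneg_right (jb_sq_le p.1) (mul_nonneg hc0.le (sq_nonneg ‖w p‖))
    calc _ = 1 * (c * ‖w p‖^2) := by ring
      _ ≤ _ := h5
      _ = _ := by ring
  linarith

lemma jb_ratio {d : ℕ} (k l : Fin d → ℤ) : jb k ≤ jb (k - l) * jb l := by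
  unfold jb
  have h : ‖k‖ ≤ ‖k - l‖ + ‖l‖ := by simpa using norm_add_le (k - l) l
  nlinarith [norm_nonneg (k - l), norm_nonneg l, mul_nonneg (norm_nonneg (k-l)) (norm_nonneg l)]

lemma jb_diff {d : ℕ} (k l : Fin d → ℤ) : |jb k - jb l| ≤ jb (k - l) := by
  unfold jb
  have h := abs_norm_sub_norm_le k l
  have : (1 + ‖k‖) - (1 + ‖l‖) = ‖k‖ - ‖l‖ := by ring
  rw [this]; linarith

lemma jb_abs {d : ℕ} (k : Fin d → ℤ) (j : Fin d) : |(k j : ℝ)| ≤ jb k := by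
  unfold jb; linarith [abs_le_norm k j]

lemma pow_bound {K L n : ℝ} (hK : 0 < K) (hL : 0 < L) (hn : 1 ≤ n) (h1 : K ≤ n * L)
    (h2 : |K - L| ≤ n) (t : ℕ) : |(K / L) ^ t - 1| * L ≤ t * n ^ t := by
  induction t with
  | zero => simp
  | succ t ih =>
    have hr0 : 0 ≤ K / L := by positivity
    have hr : K / L ≤ n := by rw [div_le_iff₀ hL]; exact h1
    have e : (K / L) ^ (t+1) - 1 = (K / L) * ((K/L)^t - 1) + (K/L - 1) := by ring
    have h3 : |K / L - 1| * L ≤ n := by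
      have : K / L - 1 = (K - L) / L := by field_simp
      rw [this, abs_div, abs_of_pos hL, div_mul_cancel₀ _ hL.ne']
      exact h2
    calc |(K / L) ^ (t+1) - 1| * L ≤ (|(K / L) * ((K/L)^t - 1)| + |K/L - 1|) * L := by
          rw [e]; gcongr; exact abs_add_le _ _
      _ = (K/L) * (|(K/L)^t - 1| * L) + |K/L - 1| * L := by
          rw [abs_mul, abs_of_nonneg hr0]; ring
      _ ≤ n * (t * n^t) + n := by gcongr
      _ ≤ n * (t * n^t) + n ^ (t+1) := by
          gcongr
          exact le_self_pow₀ hn (by omega)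
      _ = _ := by push_cast; ring

lemma T_bound {d : ℕ} (k l : Fin d → ℤ) (i j : Fin d) (t : ℕ) :
    |jb k ^ t * (jb l ^ (t+2))⁻¹ * jb l * ((l i : ℝ) * (l j : ℝ)) - (k i : ℝ) / jb k * (l j : ℝ)|
      ≤ (t + 2) * jb (k - l) ^ (t+1) := by
  have hK := jb_pos k
  have hL := jb_pos l
  have hn := jb_one_le (k - l)
  have hb := pow_bound hK hL hn (jb_ratio k l) (jb_diff k l) t
  have e : jb k ^ t * (jb l ^ (t+2))⁻¹ * jb l * ((l i : ℝ) * (l j : ℝ)) - (k i : ℝ) / jb k * (l j : ℝ)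
      = ((l j : ℝ) / jb l) * (((jb k / jb l) ^ t - 1) * (l i : ℝ)
        + (((l i : ℝ) - (k i : ℝ)) + (k i : ℝ) / jb k * (jb k - jb l))) := by
    rw [div_pow]
    field_simp
    ring
  rw [e, abs_mul]
  have a1 : |(l j : ℝ) / jb l| ≤ 1 := by
    rw [abs_div, abs_of_pos hL, div_le_one hL]; exact jb_abs l j
  have a2 : |(k i : ℝ) / jb k| ≤ 1 := by
    rw [abs_div, abs_of_pos hK, div_le_one hK]; exact jb_abs k i
  have a3 : |(l i : ℝ) - (k i : ℝ)| ≤ jb (k - l) := by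
    have := jb_abs (k - l) i
    rw [abs_sub_comm]
    simpa using this
  have a4 : |((jb k / jb l) ^ t - 1) * (l i : ℝ)| ≤ t * jb (k - l) ^ t := by
    rw [abs_mul]
    exact (mul_le_mul_of_nonneg_left (jb_abs l i) (abs_nonneg _)).trans hb
  have a5 : |(k i : ℝ) / jb k * (jb k - jb l)| ≤ jb (k - l) := by
    rw [abs_mul]
    calc _ ≤ 1 * jb (k - l) := mul_le_mul a2 (jb_diff k l) (abs_nonneg _) zero_le_one
      _ = _ := one_mul _
  have p1 : jb (k-l) ^ t ≤ jb (k-l) ^ (t+1) := pow_le_pow_right₀ hn (by omega)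
  have p2 : jb (k-l) ≤ jb (k-l) ^ (t+1) := le_self_pow₀ hn (by omega)
  calc _ ≤ 1 * |((jb k / jb l) ^ t - 1) * (l i : ℝ)
        + (((l i : ℝ) - (k i : ℝ)) + (k i : ℝ) / jb k * (jb k - jb l))| :=
        mul_le_mul_of_nonneg_right a1 (abs_nonneg _)
    _ ≤ t * jb (k - l) ^ t + (jb (k - l) + jb (k - l)) := by
        rw [one_mul]
        exact (abs_add_le _ _).trans (add_le_add a4 ((abs_add_le _ _).trans (add_le_add a3 a5)))
    _ ≤ t * jb (k-l)^(t+1) + (jb (k-l)^(t+1) + jb (k-l)^(t+1)) := by gcongr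
    _ = _ := by ring

/-- Fourier matrix of `-ℒ` plus the rank-one correction -/
def Lk {d m : ℕ} (bh : Fin m → Fin d → (Fin d → ℤ) → ℂ) (ah : Fin m → Fin d → Fin d → (Fin d → ℤ) → ℂ)
    (qh : Fin m → Fin m → (Fin d → ℤ) → ℂ) (p r : (Fin d → ℤ) × Fin m) : ℂ :=
  -((if p.2 = r.2 then (∑ j, bh p.2 j (p.1 - r.1) * (2 * Real.pi * Complex.I * (r.1 j : ℂ)))
      + (1/2) * ∑ i, ∑ j, ah p.2 i j (p.1 - r.1) *
        ((2 * Real.pi * Complex.I * (r.1 j : ℂ)) * (2 * Real.pi * Complex.I * (r.1 i : ℂ))) else 0)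
    + qh p.2 r.2 (p.1 - r.1)) + (if p.1 = 0 ∧ r.1 = 0 then 1 else 0)

def KSk {d m : ℕ} (bh : Fin m → Fin d → (Fin d → ℤ) → ℂ) (ah : Fin m → Fin d → Fin d → (Fin d → ℤ) → ℂ)
    (qh : Fin m → Fin m → (Fin d → ℤ) → ℂ) (t : ℕ) (p r : (Fin d → ℤ) × Fin m) : ℂ :=
  ((jb p.1 ^ t : ℝ) : ℂ) * Lk bh ah qh p r * (((jb r.1 ^ (t+2))⁻¹ : ℝ) : ℂ)

lemma dec {C0 n : ℝ} (hC0 : 0 ≤ C0) (hn : 1 ≤ n) (t D s : ℕ) (hs : s ≤ t + 1) :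
    C0 * (n ^ (t+1+D))⁻¹ * n ^ s ≤ C0 * (n ^ D)⁻¹ := by
  have hp : 0 < n := by linarith
  rw [mul_assoc]
  apply mul_le_mul_of_nonneg_left _ hC0
  rw [pow_add, mul_inv, mul_comm, ← mul_assoc]
  apply mul_le_of_le_one_left (by positivity)
  rw [mul_inv_le_iff₀ (by positivity), one_mul]
  exact pow_le_pow_right₀ hn hs

lemma KA_bound {d m : ℕ} (ah : Fin m → Fin d → Fin d → (Fin d → ℤ) → ℂ) (C0 c : ℝ) (hc : 0 ≤ c) (t : ℕ)
    (hC0 : 0 ≤ C0) (hah : ∀ α i j k, ‖ah α i j k‖ ≤ C0 * (jb k ^ (t+1+2*d))⁻¹)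
    (p r : (Fin d → ℤ) × Fin m) :
    ‖KAk ah c p r‖ ≤ (2 * Real.pi^2 * (d * (d * C0)) + 2 * c) * (jb (p.1 - r.1) ^ (2*d))⁻¹ := by
  obtain ⟨E, hE⟩ : ∃ E, E = (jb (p.1 - r.1) ^ (2*d))⁻¹ := ⟨_, rfl⟩
  have hE0 : 0 < E := by rw [hE]; have := jb_pos (p.1 - r.1); positivity
  rw [← hE]
  have hpi : 0 ≤ Real.pi^2 := by positivity
  unfold KAk
  split_ifs with h h1
  all_goals try (simp only [norm_zero]; positivity)
  all_goals
    have key : ‖((2 * Real.pi ^ 2 : ℝ) : ℂ) * ∑ i, ∑ j, ah p.2 i j (p.1 - r.1) *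
      (((p.1 i : ℝ) / jb p.1 * ((r.1 j : ℝ) / jb r.1) : ℝ) : ℂ)‖ ≤ (2 * Real.pi^2 * (d * (d * C0))) * E := by
      rw [norm_mul, Complex.norm_real, Real.norm_of_nonneg (by positivity), mul_assoc (2 * Real.pi^2)]
      apply mul_le_mul_of_nonneg_left _ (by positivity)
      have hh : ∀ i j, ‖ah p.2 i j (p.1 - r.1) * (((p.1 i : ℝ) / jb p.1 * ((r.1 j : ℝ) / jb r.1) : ℝ) : ℂ)‖ ≤ C0 * E := by
        intro i j
        have a1 : ∀ (k : Fin d → ℤ) i, |(k i : ℝ) / jb k| ≤ 1 := by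
          intro k i
          rw [abs_div, abs_of_pos (jb_pos k), div_le_one (jb_pos k)]; exact jb_abs k i
        rw [norm_mul, Complex.norm_real, Real.norm_eq_abs, abs_mul]
        calc _ ≤ ‖ah p.2 i j (p.1 - r.1)‖ * (1 * 1) := by gcongr <;> apply a1
          _ ≤ C0 * (jb (p.1 - r.1) ^ (t+1+2*d))⁻¹ * (jb (p.1 - r.1))^0 := by
            simpa using hah p.2 i j (p.1 - r.1)
          _ ≤ _ := by rw [hE]; exact dec hC0 (jb_one_le _) t (2*d) 0 (by omega)
      calc _ ≤ ∑ i : Fin d, ∑ j : Fin d, C0 * E := (norm_sum_le _ _).trans (Finset.sum_le_sum fun i _ =>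
            (norm_sum_le _ _).trans (Finset.sum_le_sum fun j _ => hh i j))
        _ = _ := by simp; ring
  · have k2 : ‖((2 * c / jb p.1 : ℝ) : ℂ)‖ ≤ 2 * c * E := by
      have hp := jb_pos p.1
      rw [Complex.norm_real, Real.norm_of_nonneg (by positivity)]
      have : E = 1 := by rw [hE, h1]; simp [jb]
      rw [this, mul_one]
      exact div_le_self (by positivity) (jb_one_le _)
    calc _ ≤ _ := norm_add_le _ _
      _ ≤ _ := add_le_add key k2
      _ = _ := by ring
  · rw [add_zero]
    refine key.trans ?_
    apply mul_le_mul_of_nonneg_right _ hE0.le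
    linarith

lemma R_bound {d : ℕ} (k l : Fin d → ℤ) (t : ℕ) :
    jb k ^ t * (jb l ^ (t+2))⁻¹ * jb l * jb l ≤ jb (k - l) ^ t := by
  have hL := jb_pos l
  have h := pow_le_pow_left₀ (jb_pos k).le (jb_ratio k l) t
  have e : jb k ^ t * (jb l ^ (t+2))⁻¹ * jb l * jb l = jb k ^ t / jb l ^ t := by
    field_simp
    ring
  rw [e, div_le_iff₀ (by positivity), ← mul_pow]
  exact h

lemma KC_eq {d m : ℕ} (bh : Fin m → Fin d → (Fin d → ℤ) → ℂ) (ah : Fin m → Fin d → Fin d → (Fin d → ℤ) → ℂ)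
    (qh : Fin m → Fin m → (Fin d → ℤ) → ℂ) (c : ℝ) (t : ℕ) (p r : (Fin d → ℤ) × Fin m) (R : ℝ)
    (hR : R = jb p.1 ^ t * (jb r.1 ^ (t+2))⁻¹ * jb r.1) :
    (KSk bh ah qh t p r - KAk ah c p r) * ((jb r.1 : ℝ) : ℂ)
      = (if p.2 = r.2 then - (∑ j, bh p.2 j (p.1 - r.1) * ((2 * Real.pi * Complex.I * (r.1 j : ℂ)) * R))
          + ((2 * Real.pi ^ 2 : ℝ) : ℂ) * ∑ i, ∑ j, ah p.2 i j (p.1 - r.1) *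
            ((R * ((r.1 i : ℝ) * (r.1 j : ℝ)) - (p.1 i : ℝ) / jb p.1 * (r.1 j : ℝ) : ℝ) : ℂ)
          - (if p.1 = r.1 then ((2 * c : ℝ) : ℂ) else 0) else 0)
        - qh p.2 r.2 (p.1 - r.1) * R + (if p.1 = 0 ∧ r.1 = 0 then (R : ℂ) else 0) := by
  have hp : (jb p.1 : ℂ) ≠ 0 := by exact_mod_cast (jb_pos p.1).ne'
  have hr : (jb r.1 : ℂ) ≠ 0 := by exact_mod_cast (jb_pos r.1).ne'
  have hRc : ((jb p.1 ^ t : ℝ) : ℂ) * (((jb r.1 ^ (t+2))⁻¹ : ℝ) : ℂ) * (jb r.1 : ℂ) = (R : ℂ) := by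
    rw [hR]; push_cast; ring
  have e0 : (KSk bh ah qh t p r) * ((jb r.1 : ℝ) : ℂ) = Lk bh ah qh p r * R := by
    rw [← hRc]; unfold KSk; ring
  rw [sub_mul, e0]
  unfold Lk KAk
  by_cases h : p.2 = r.2
  · simp only [if_pos h]
    have e1 : ((2 * Real.pi ^ 2 : ℝ) : ℂ) * ∑ i, ∑ j, ah p.2 i j (p.1 - r.1) *
            ((R * ((r.1 i : ℝ) * (r.1 j : ℝ)) - (p.1 i : ℝ) / jb p.1 * (r.1 j : ℝ) : ℝ) : ℂ)
        = -((1/2) * ∑ i, ∑ j, ah p.2 i j (p.1 - r.1) *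
        ((2 * Real.pi * Complex.I * (r.1 j : ℂ)) * (2 * Real.pi * Complex.I * (r.1 i : ℂ)))) * R
        - (((2 * Real.pi ^ 2 : ℝ) : ℂ) * ∑ i, ∑ j, ah p.2 i j (p.1 - r.1) *
      (((p.1 i : ℝ) / jb p.1 * ((r.1 j : ℝ) / jb r.1) : ℝ) : ℂ)) * jb r.1 := by
      simp only [Finset.mul_sum, Finset.sum_mul, ← Finset.sum_neg_distrib, ← Finset.sum_sub_distrib]
      refine Finset.sum_congr rfl fun i _ => Finset.sum_congr rfl fun j _ => ?_
      push_cast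
      have hI : ∀ u v : ℂ, (2 * (Real.pi:ℂ) * Complex.I * u) * (2 * Real.pi * Complex.I * v)
          = -(4 * (Real.pi:ℂ)^2 * (u * v)) := by
        intro u v
        linear_combination 4 * (Real.pi:ℂ)^2 * u * v * Complex.I_mul_I
      rw [hI]
      field_simp
      ring
    have e2 : ∑ j, bh p.2 j (p.1 - r.1) * ((2 * Real.pi * Complex.I * (r.1 j : ℂ)) * R)
        = (∑ j, bh p.2 j (p.1 - r.1) * (2 * Real.pi * Complex.I * (r.1 j : ℂ))) * R := by
      rw [Finset.sum_mul]; exact Finset.sum_congr rfl fun j _ => by ring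
    have e3 : (if p.1 = r.1 then ((2 * c : ℝ) : ℂ) else 0)
        = (if p.1 = r.1 then ((2 * c / jb p.1 : ℝ) : ℂ) else 0) * jb r.1 := by
      split_ifs with h1
      · rw [← h1]; push_cast; field_simp
      · ring
    have e4 : (if p.1 = 0 ∧ r.1 = 0 then (R : ℂ) else 0) = (if p.1 = 0 ∧ r.1 = 0 then 1 else 0) * (R:ℂ) := by
      split_ifs <;> ring
    rw [e1, e2, e3, e4]
    ring
  · simp only [if_neg h]
    split_ifs <;> ring

lemma KC_bound {d m : ℕ} (bh : Fin m → Fin d → (Fin d → ℤ) → ℂ) (ah : Fin m → Fin d → Fin d → (Fin d → ℤ) → ℂ)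
    (qh : Fin m → Fin m → (Fin d → ℤ) → ℂ) (C0 c : ℝ) (hc : 0 ≤ c) (t : ℕ)
    (hC0 : 0 ≤ C0) (hah : ∀ α i j k, ‖ah α i j k‖ ≤ C0 * (jb k ^ (t+1+2*d))⁻¹)
    (hbh : ∀ α j k, ‖bh α j k‖ ≤ C0 * (jb k ^ (t+1+2*d))⁻¹)
    (hqh : ∀ α β k, ‖qh α β k‖ ≤ C0 * (jb k ^ (t+1+2*d))⁻¹)
    (p r : (Fin d → ℤ) × Fin m) :
    ‖(KSk bh ah qh t p r - KAk ah c p r) * ((jb r.1 : ℝ) : ℂ)‖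
      ≤ (d * (2 * Real.pi * C0) + 2 * Real.pi^2 * (d * (d * ((t+2) * C0))) + 2 * c + C0 + 1)
        * (jb (p.1 - r.1) ^ (2*d))⁻¹ := by
  obtain ⟨R, hR⟩ : ∃ R, R = jb p.1 ^ t * (jb r.1 ^ (t+2))⁻¹ * jb r.1 := ⟨_, rfl⟩
  obtain ⟨E, hE⟩ : ∃ E, E = (jb (p.1 - r.1) ^ (2*d))⁻¹ := ⟨_, rfl⟩
  have hE0 : 0 < E := by rw [hE]; have := jb_pos (p.1 - r.1); positivity
  have hpi := Real.pi_pos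
  have hjp := jb_pos p.1
  have hjr := jb_pos r.1
  have hjn := jb_one_le (p.1 - r.1)
  have hR0 : 0 ≤ R := by rw [hR]; positivity
  have hRb : R * jb r.1 ≤ jb (p.1 - r.1) ^ t := by rw [hR]; exact R_bound _ _ _
  have hRb' : R ≤ jb (p.1 - r.1) ^ t := le_trans (le_mul_of_one_le_right hR0 (jb_one_le _)) hRb
  rw [KC_eq bh ah qh c t p r R hR, ← hE]
  have q1 : ‖qh p.2 r.2 (p.1 - r.1) * R‖ ≤ C0 * E := by
    rw [norm_mul, Complex.norm_real, Real.norm_of_nonneg hR0, hE]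
    refine le_trans (mul_le_mul (hqh _ _ _) hRb' hR0 (by positivity)) (dec hC0 hjn t (2*d) t (by omega))
  have o1 : ‖(if p.1 = 0 ∧ r.1 = 0 then (R : ℂ) else 0)‖ ≤ 1 * E := by
    split_ifs with h
    · rw [Complex.norm_real, Real.norm_of_nonneg hR0, hR, hE, h.1, h.2]
      simp [jb]
    · simp [hE0.le]
  have d1 : ‖(if p.1 = r.1 then ((2 * c : ℝ) : ℂ) else 0)‖ ≤ 2 * c * E := by
    split_ifs with h
    · rw [Complex.norm_real, Real.norm_of_nonneg (by positivity), hE, h]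
      simp [jb]
    · simp only [norm_zero]; positivity
  have b1 : ‖∑ j, bh p.2 j (p.1 - r.1) * ((2 * Real.pi * Complex.I * (r.1 j : ℂ)) * R)‖ ≤ d * (2 * Real.pi * C0) * E := by
    have hh : ∀ j, ‖bh p.2 j (p.1 - r.1) * ((2 * Real.pi * Complex.I * (r.1 j : ℂ)) * R)‖ ≤ 2 * Real.pi * C0 * E := by
      intro j
      rw [norm_mul, norm_mul, Complex.norm_real, Real.norm_of_nonneg hR0]
      have := Dc_norm j r.1
      calc _ ≤ (C0 * (jb (p.1 - r.1) ^ (t+1+2*d))⁻¹) * ((2 * Real.pi * jb r.1) * R) := by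
            gcongr; exact hbh _ _ _
        _ = 2 * Real.pi * ((C0 * (jb (p.1 - r.1) ^ (t+1+2*d))⁻¹) * (R * jb r.1)) := by ring
        _ ≤ 2 * Real.pi * ((C0 * (jb (p.1 - r.1) ^ (t+1+2*d))⁻¹) * (jb (p.1 - r.1) ^ t)) := by gcongr
        _ ≤ 2 * Real.pi * (C0 * E) := by
            rw [hE]
            exact mul_le_mul_of_nonneg_left (dec hC0 hjn t (2*d) t (by omega)) (by positivity)
        _ = _ := by ring
    calc _ ≤ ∑ j : Fin d, 2 * Real.pi * C0 * E := (norm_sum_le _ _).trans (Finset.sum_le_sum fun j _ => hh j)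
      _ = _ := by simp; ring
  have a1 : ‖((2 * Real.pi ^ 2 : ℝ) : ℂ) * ∑ i, ∑ j, ah p.2 i j (p.1 - r.1) *
            ((R * ((r.1 i : ℝ) * (r.1 j : ℝ)) - (p.1 i : ℝ) / jb p.1 * (r.1 j : ℝ) : ℝ) : ℂ)‖
      ≤ 2 * Real.pi^2 * (d * (d * ((t+2) * C0))) * E := by
    rw [norm_mul, Complex.norm_real, Real.norm_of_nonneg (by positivity), mul_assoc (2 * Real.pi^2)]
    apply mul_le_mul_of_nonneg_left _ (by positivity)
    have hh : ∀ i j, ‖ah p.2 i j (p.1 - r.1) * ((R * ((r.1 i : ℝ) * (r.1 j : ℝ)) - (p.1 i : ℝ) / jb p.1 * (r.1 j : ℝ) : ℝ) : ℂ)‖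
        ≤ (t + 2) * C0 * E := by
      intro i j
      rw [norm_mul, Complex.norm_real, Real.norm_eq_abs, hR]
      calc _ ≤ (C0 * (jb (p.1 - r.1) ^ (t+1+2*d))⁻¹) * ((t + 2) * jb (p.1 - r.1) ^ (t+1)) :=
            mul_le_mul (hah _ _ _ _) (T_bound _ _ _ _ _) (abs_nonneg _) (by positivity)
        _ = (t+2) * ((C0 * (jb (p.1 - r.1) ^ (t+1+2*d))⁻¹) * jb (p.1 - r.1) ^ (t+1)) := by ring
        _ ≤ (t+2) * (C0 * E) := by
            rw [hE]
            exact mul_le_mul_of_nonneg_left (dec hC0 hjn t (2*d) (t+1) le_rfl) (by positivity)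
        _ = _ := by ring
    calc _ ≤ ∑ i : Fin d, ∑ j : Fin d, (t+2) * C0 * E := (norm_sum_le _ _).trans (Finset.sum_le_sum fun i _ =>
          (norm_sum_le _ _).trans (Finset.sum_le_sum fun j _ => hh i j))
      _ = _ := by simp; ring
  have f1 : ∀ X Y Z : ℂ, ‖-X + Y - Z‖ ≤ ‖X‖ + ‖Y‖ + ‖Z‖ := fun X Y Z => by
    calc _ ≤ ‖-X + Y‖ + ‖Z‖ := norm_sub_le _ _
      _ ≤ _ := by have := norm_add_le (-X) Y; rw [norm_neg] at this; linarith
  have f2 : ∀ X Y Z : ℂ, ‖X - Y + Z‖ ≤ ‖X‖ + ‖Y‖ + ‖Z‖ := fun X Y Z => by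
    calc _ ≤ ‖X - Y‖ + ‖Z‖ := norm_add_le _ _
      _ ≤ _ := by have := norm_sub_le X Y; linarith
  refine (f2 _ _ _).trans ?_
  have nn1 : 0 ≤ d * (2 * Real.pi * C0) * E := by positivity
  have nn2 : 0 ≤ 2 * Real.pi^2 * (d * (d * ((t+2) * C0))) * E := by positivity
  have nn3 : 0 ≤ 2 * c * E := by positivity
  by_cases h : p.2 = r.2
  · rw [if_pos h]
    have := f1 (∑ j, bh p.2 j (p.1 - r.1) * ((2 * Real.pi * Complex.I * (r.1 j : ℂ)) * R))
      (((2 * Real.pi ^ 2 : ℝ) : ℂ) * ∑ i, ∑ j, ah p.2 i j (p.1 - r.1) *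
            ((R * ((r.1 i : ℝ) * (r.1 j : ℝ)) - (p.1 i : ℝ) / jb p.1 * (r.1 j : ℝ) : ℝ) : ℂ))
      (if p.1 = r.1 then ((2 * c : ℝ) : ℂ) else 0)
    linarith
  · rw [if_neg h, norm_zero]
    linarith

lemma hat_add {d : ℕ} {f g : (Fin d → ℝ) → ℂ} (hf : Continuous f) (hg : Continuous g) (k : Fin d → ℤ) :
    hat (fun x => f x + g x) k = hat f k + hat g k := by
  have h1 : Integrable (fun x => f x * ee (-k) x) (volume.restrict (cube d)) :=
    cube_integrable (hf.mul (ee_continuous _))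
  have h2 : Integrable (fun x => g x * ee (-k) x) (volume.restrict (cube d)) :=
    cube_integrable (hg.mul (ee_continuous _))
  unfold hat
  rw [← integral_add h1 h2]
  congr 1; funext x; ring

lemma hat_sum {d : ℕ} {ι : Type*} (s : Finset ι) {f : ι → (Fin d → ℝ) → ℂ} (hf : ∀ i, Continuous (f i))
    (k : Fin d → ℤ) : hat (fun x => ∑ i ∈ s, f i x) k = ∑ i ∈ s, hat (f i) k := by
  have h1 : ∀ i ∈ s, Integrable (fun x => f i x * ee (-k) x) (volume.restrict (cube d)) :=
    fun i _ => cube_integrable ((hf i).mul (ee_continuous _))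
  unfold hat
  rw [← integral_finsetSum _ h1]
  congr 1; funext x; rw [Finset.sum_mul]

lemma hat_const_mul {d : ℕ} (c : ℂ) (f : (Fin d → ℝ) → ℂ) (k : Fin d → ℤ) :
    hat (fun x => c * f x) k = c * hat f k := by
  unfold hat
  rw [← integral_const_mul]
  congr 1; funext x; ring

/-- the complexified generator applied to a Fourier series -/
def G1 {d m : ℕ} (b : (Fin d → ℝ) → Fin m → Fin d → ℝ) (a : (Fin d → ℝ) → Fin m → Matrix (Fin d) (Fin d) ℝ)
    (c : (Fin d → ℤ) → ℂ) (α : Fin m) (x : Fin d → ℝ) : ℂ :=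
  (∑ j, (b x α j : ℂ) * FS (Dc j c) x) + (1/2) * ∑ i, ∑ j, (a x α i j : ℂ) * FS (Dc j (Dc i c)) x

def G2 {d m : ℕ} (q : Fin m → Fin m → (Fin d → ℝ) → ℝ) (c : (Fin d → ℤ) × Fin m → ℂ) (α : Fin m)
    (x : Fin d → ℝ) : ℂ := ∑ β, (q α β x : ℂ) * FS (fun l => c (l, β)) x

section
variable {d m : ℕ} {b : (Fin d → ℝ) → Fin m → Fin d → ℝ} {a : (Fin d → ℝ) → Fin m → Matrix (Fin d) (Fin d) ℝ}
  {q : Fin m → Fin m → (Fin d → ℝ) → ℝ} {c : (Fin d → ℤ) × Fin m → ℂ}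

lemma G1_cont (hb : ∀ α j, Continuous fun x => b x α j) (ha : ∀ α i j, Continuous fun x => a x α i j)
    {c : (Fin d → ℤ) → ℂ} (hc : WS 2 c) (α : Fin m) : Continuous (G1 b a c α) := by
  unfold G1
  refine Continuous.add ?_ (continuous_const.mul ?_)
  · exact continuous_finsetSum _ fun j _ => (Complex.continuous_ofReal.comp (hb α j)).mul
      (FS_continuous (hc.Dc j).zero_summable)
  · exact continuous_finsetSum _ fun i _ => continuous_finsetSum _ fun j _ =>
      (Complex.continuous_ofReal.comp (ha α i j)).mul (FS_continuous ((hc.Dc i).Dc j).zero_summable)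

lemma G2_cont (hq : ∀ α β, Continuous (q α β)) (hc : ∀ β, WS 2 fun l => c (l, β)) (α : Fin m) :
    Continuous (G2 q c α) := by
  unfold G2
  exact continuous_finsetSum _ fun β _ => (Complex.continuous_ofReal.comp (hq α β)).mul
      (FS_continuous (hc β).zero_summable)

lemma G1_per (hb : ∀ α j, Per fun x => b x α j) (ha : ∀ α i j, Per fun x => a x α i j)
    (c : (Fin d → ℤ) → ℂ) (α : Fin m) : PerE (G1 b a c α) := by
  intro x ν
  unfold G1
  have h1 : ∀ j, b (x + fun i => (ν i : ℝ)) α j = b x α j := fun j => hb α j x ν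
  have h2 : ∀ i j, a (x + fun i => (ν i : ℝ)) α i j = a x α i j := fun i j => ha α i j x ν
  simp only [h1, h2, FS_per _ x ν]

lemma G2_per (hq : ∀ α β, Per (q α β)) (c : (Fin d → ℤ) × Fin m → ℂ) (α : Fin m) : PerE (G2 q c α) := by
  intro x ν
  unfold G2
  have h1 : ∀ β, q α β (x + fun i => (ν i : ℝ)) = q α β x := fun β => hq α β x ν
  simp only [h1, FS_per _ x ν]

lemma gen_FS (hq_diag : ∀ α x, q α α x = -∑ β ∈ Finset.univ.filter (fun β => β ≠ α), q α β x)
    (hc : ∀ β, WS 2 fun l => c (l, β)) (φ : ℂ →L[ℝ] ℝ) (x : Fin d → ℝ) (α : Fin m) :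
    gen b a q (fun x α => φ (FS (fun l => c (l, α)) x)) x α
      = φ (G1 b a (fun l => c (l, α)) α x + G2 q c α x) := by
  have hs : ∀ (s : ℝ) (z : ℂ), φ ((s : ℂ) * z) = s * φ z := by
    intro s z
    rw [← Complex.real_smul, map_smul, smul_eq_mul]
  have hhalf : ∀ z : ℂ, φ ((1/2) * z) = (1/2) * φ z := by
    intro z
    have := hs (1/2) z
    push_cast at this
    exact this
  unfold gen G1 G2
  rw [jump_eq q hq_diag]
  simp only [pd_comp_FS φ ((hc α).mono (by norm_num : 1 ≤ 2)), pd2_comp_FS φ (hc α), map_add, map_sum, hs, hhalf]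

lemma G1_hat (hb : ∀ α j, Continuous fun x => b x α j) (ha : ∀ α i j, Continuous fun x => a x α i j)
    {c : (Fin d → ℤ) → ℂ} (hc : WS 2 c) (α : Fin m) (k : Fin d → ℤ) :
    HasSum (fun l => ((∑ j, hat (fun x => (b x α j : ℂ)) (k - l) * (2 * Real.pi * Complex.I * (l j : ℂ)))
      + (1/2) * ∑ i, ∑ j, hat (fun x => (a x α i j : ℂ)) (k - l) *
        ((2 * Real.pi * Complex.I * (l j : ℂ)) * (2 * Real.pi * Complex.I * (l i : ℂ)))) * c l)
      (hat (G1 b a c α) k) := by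
  have hbC : ∀ j, Continuous fun x => (b x α j : ℂ) := fun j => Complex.continuous_ofReal.comp (hb α j)
  have haC : ∀ i j, Continuous fun x => (a x α i j : ℂ) := fun i j => Complex.continuous_ofReal.comp (ha α i j)
  have t1 : ∀ j, Continuous fun x => (b x α j : ℂ) * FS (Dc j c) x := fun j =>
    (hbC j).mul (FS_continuous (hc.Dc j).zero_summable)
  have t2 : ∀ i j, Continuous fun x => (a x α i j : ℂ) * FS (Dc j (Dc i c)) x := fun i j =>
    (haC i j).mul (FS_continuous ((hc.Dc i).Dc j).zero_summable)
  have t2' : ∀ i, Continuous fun x => ∑ j, (a x α i j : ℂ) * FS (Dc j (Dc i c)) x := fun i =>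
    continuous_finsetSum _ fun j _ => t2 i j
  have t3 : Continuous fun x => (1/2 : ℂ) * ∑ i, ∑ j, (a x α i j : ℂ) * FS (Dc j (Dc i c)) x :=
    continuous_const.mul (continuous_finsetSum _ fun i _ => t2' i)
  have t4 : Continuous fun x => ∑ j, (b x α j : ℂ) * FS (Dc j c) x := continuous_finsetSum _ fun j _ => t1 j
  have e : hat (G1 b a c α) k = (∑ j, hat (fun x => (b x α j : ℂ) * FS (Dc j c) x) k)
      + (1/2) * ∑ i, ∑ j, hat (fun x => (a x α i j : ℂ) * FS (Dc j (Dc i c)) x) k := by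
    unfold G1
    rw [hat_add t4 t3, hat_sum _ t1, hat_const_mul, hat_sum _ t2']
    simp only [fun i => hat_sum Finset.univ (t2 i) k]
  rw [e]
  have s1 := hasSum_sum (s := Finset.univ) (fun (j : Fin d) _ => hat_mul_FS (hbC j) (c := Dc j c) (hc.Dc j).zero_summable k)
  have s2 := hasSum_sum (s := Finset.univ) (fun (i : Fin d) _ => hasSum_sum (s := Finset.univ) (fun (j : Fin d) _ =>
    hat_mul_FS (haC i j) (c := Dc j (Dc i c)) ((hc.Dc i).Dc j).zero_summable k))
  have s3 := s1.add (s2.mul_left (1/2 : ℂ))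
  refine s3.congr_fun ?_
  intro l
  unfold Dc
  rw [add_mul, Finset.sum_mul, mul_assoc (1/2 : ℂ), Finset.sum_mul]
  congr 1
  · exact Finset.sum_congr rfl fun j _ => by ring
  · congr 1
    refine Finset.sum_congr rfl fun i _ => ?_
    rw [Finset.sum_mul]
    exact Finset.sum_congr rfl fun j _ => by ring

lemma Lk_hat (hb : ∀ α j, Continuous fun x => b x α j) (ha : ∀ α i j, Continuous fun x => a x α i j)
    (hq : ∀ α β, Continuous (q α β)) (hc : ∀ β, WS 2 fun l => c (l, β)) (k : Fin d → ℤ) (α : Fin m) :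
    HasSum (fun r => Lk (fun α j => hat (fun x => (b x α j : ℂ))) (fun α i j => hat (fun x => (a x α i j : ℂ)))
      (fun α β => hat (fun x => (q α β x : ℂ))) (k, α) r * c r)
      (hat (fun x => (-1) * (G1 b a (fun l => c (l, α)) α x + G2 q c α x) + ∑ β, c (0, β)) k) := by
  have hG1 := G1_cont hb ha (hc α) α
  have hG2 := G2_cont hq hc α
  have hqC : ∀ β, Continuous fun x => (q α β x : ℂ) := fun β => Complex.continuous_ofReal.comp (hq α β)
  have hG2h : hat (G2 q c α) k = ∑ β, hat (fun x => (q α β x : ℂ) * FS (fun l => c (l, β)) x) k := by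
    unfold G2
    exact hat_sum _ (fun β => (hqC β).mul (FS_continuous (hc β).zero_summable)) k
  have e : hat (fun x => (-1) * (G1 b a (fun l => c (l, α)) α x + G2 q c α x) + ∑ β, c (0, β)) k
      = ∑ β, (-((if α = β then hat (G1 b a (fun l => c (l, β)) α) k else 0)
        + hat (fun x => (q α β x : ℂ) * FS (fun l => c (l, β)) x) k) + (if k = 0 then c (0, β) else 0)) := by
    have hG12 : Continuous fun x => (-1 : ℂ) * (G1 b a (fun l => c (l, α)) α x + G2 q c α x) :=
      continuous_const.mul (hG1.add hG2)
    rw [hat_add hG12 continuous_const, hat_const_mul, hat_add hG1 hG2, hat_const,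
      hG2h, Finset.sum_add_distrib, Finset.sum_neg_distrib, Finset.sum_add_distrib, Finset.sum_ite_eq]
    simp only [Finset.mem_univ, if_true]
    congr 1
    · ring
    · split_ifs <;> simp
  rw [e]
  apply hasSum_prod_fin
  intro β
  have h1 := hat_mul_FS (hqC β) (hc β).zero_summable k
  have h2 : HasSum (fun l : Fin d → ℤ => (if k = 0 ∧ l = 0 then (1:ℂ) else 0) * c (l, β)) (if k = 0 then c (0, β) else 0) := by
    have := hasSum_ite_eq (0 : Fin d → ℤ) (if k = 0 then c (0, β) else 0)
    refine this.congr_fun ?_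
    intro l
    by_cases hl : l = 0
    · subst hl; by_cases hk : k = 0 <;> simp [hk]
    · simp [hl]
  by_cases h : α = β
  · subst h
    have h3 := ((G1_hat hb ha (hc α) α k).add h1).neg.add h2
    simp only [if_true]
    refine h3.congr_fun ?_
    intro l
    unfold Lk
    simp only [if_true]
    ring
  · simp only [if_neg h, zero_add]
    refine (h1.neg.add h2).congr_fun ?_
    intro l
    unfold Lk
    simp only [if_neg h]
    ring

end

lemma Summable_fst {ι : Type*} {m : ℕ} {g : ι → ℝ} (hg : Summable g) :
    Summable fun p : ι × Fin m => g p.1 :=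
  (hasSum_prod_fin (F := fun p : ι × Fin m => g p.1) (fun _ => hg.hasSum)).summable

lemma phi_tendsto {d m : ℕ} (hd : 0 < d) :
    Filter.Tendsto (fun p : (Fin d → ℤ) × Fin m => (((jb p.1)⁻¹ : ℝ) : ℂ)) Filter.cofinite (nhds 0) := by
  have h := (Summable_fst (m := m) (summable_jb d)).tendsto_cofinite_zero
  rw [tendsto_zero_iff_norm_tendsto_zero]
  rw [Metric.tendsto_nhds] at h ⊢
  intro ε hε
  filter_upwards [h (ε ^ (2*d)) (by positivity)] with p hp
  have hj := jb_pos p.1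
  rw [Real.dist_eq, sub_zero, abs_of_nonneg (by positivity), ← inv_pow] at hp
  rw [Real.dist_eq, sub_zero, abs_of_nonneg (norm_nonneg _), Complex.norm_real, Real.norm_of_nonneg (by positivity)]
  exact lt_of_pow_lt_pow_left₀ _ hε.le hp

lemma HS_summable {J : Type*} (w : HS J) : Summable fun p => ‖w p‖ ^ 2 := by
  have h := (lp.memℓp w).summable (by norm_num)
  simpa using h

lemma WS_of_HS {d m : ℕ} (w : HS ((Fin d → ℤ) × Fin m)) (β : Fin m) :
    WS 2 fun l => (((jb l ^ (2*d+2))⁻¹ : ℝ) : ℂ) * w (l, β) := by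
  have h1 : Summable fun l => ‖w (l, β)‖ ^ 2 :=
    (HS_summable w).comp_injective (i := fun l => (l, β)) fun a b hab => (Prod.mk.inj hab).1
  have h2 := (summable_jb d).add h1
  refine Summable.of_nonneg_of_le (fun k => by have := jb_pos k; positivity) (fun k => ?_) h2
  have hj := jb_pos k
  rw [norm_mul, Complex.norm_real, Real.norm_of_nonneg (by positivity)]
  have e : jb k ^ 2 * ((jb k ^ (2*d+2))⁻¹ * ‖w (k, β)‖) = (jb k ^ (2*d))⁻¹ * ‖w (k, β)‖ := by
    rw [pow_add]; field_simp
  rw [e]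
  have h3 : (jb k ^ (2*d))⁻¹ ≤ 1 := inv_le_one_of_one_le₀ (one_le_pow₀ (jb_one_le k))
  have h4 : 0 < (jb k ^ (2*d))⁻¹ := by positivity
  have h5 := norm_nonneg (w (k, β))
  nlinarith [sq_nonneg ((jb k ^ (2*d))⁻¹ - ‖w (k, β)‖)]

lemma decay_unif {d : ℕ} {ι : Type*} [Fintype ι] (h : ι → (Fin d → ℝ) → ℂ)
    (hh : ∀ i, ContDiff ℝ (⊤ : ℕ∞) (h i)) (hp : ∀ i, PerE (h i)) (N : ℕ) :
    ∃ C, 0 ≤ C ∧ ∀ i k, ‖hat (h i) k‖ ≤ C * (jb k ^ N)⁻¹ := by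
  choose C hC hb using fun i => hat_decay (h i) (hh i) (hp i) N
  refine ⟨∑ i, C i, Finset.sum_nonneg fun i _ => hC i, fun i k => (hb i k).trans ?_⟩
  have hj := jb_pos k
  exact mul_le_mul_of_nonneg_right (Finset.single_le_sum (fun i _ => hC i) (Finset.mem_univ i)) (by positivity)

/-- coefficients of the solution -/
def co {d m : ℕ} (w : HS ((Fin d → ℤ) × Fin m)) (p : (Fin d → ℤ) × Fin m) : ℂ :=
  (((jb p.1 ^ (2*d+2))⁻¹ : ℝ) : ℂ) * w p

section
variable {d m : ℕ} {b : (Fin d → ℝ) → Fin m → Fin d → ℝ} {a : (Fin d → ℝ) → Fin m → Matrix (Fin d) (Fin d) ℝ}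
  {q : Fin m → Fin m → (Fin d → ℝ) → ℝ}

lemma fourier_solve (hb : ∀ α j, Continuous fun x => b x α j) (ha : ∀ α i j, Continuous fun x => a x α i j)
    (hq : ∀ α β, Continuous (q α β)) (hbp : ∀ α j, Per fun x => b x α j)
    (hap : ∀ α i j, Per fun x => a x α i j) (hqp : ∀ α β, Per (q α β))
    (Ψ : Fin m → (Fin d → ℝ) → ℂ) (hΨ : ∀ α, Continuous (Ψ α)) (hΨp : ∀ α, PerE (Ψ α))
    (w : HS ((Fin d → ℤ) × Fin m))
    (hw : ∀ p : (Fin d → ℤ) × Fin m, HasSum (fun r => KSk (fun α j => hat (fun x => (b x α j : ℂ)))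
      (fun α i j => hat (fun x => (a x α i j : ℂ)))
      (fun α β => hat (fun x => (q α β x : ℂ))) (2*d) p r * w r) (((jb p.1 ^ (2*d) : ℝ) : ℂ) * hat (Ψ p.2) p.1))
    (α : Fin m) (x : Fin d → ℝ) :
    G1 b a (fun l => co w (l, α)) α x + G2 q (co w) α x = (∑ β, co w (0, β)) - Ψ α x := by
  have hc : ∀ β, WS 2 fun l => co w (l, β) := fun β => WS_of_HS w β
  have hG1 := G1_cont hb ha (hc α) α
  have hG2 := G2_cont hq hc α
  have c1 : Continuous fun x => (-1 : ℂ) * (G1 b a (fun l => co w (l, α)) α x + G2 q (co w) α x) + ∑ β, co w (0, β) :=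
    (continuous_const.mul (hG1.add hG2)).add continuous_const
  have c2 : Continuous fun x => (-1 : ℂ) * Ψ α x := continuous_const.mul (hΨ α)
  have c3 : Continuous fun x => ((-1 : ℂ) * (G1 b a (fun l => co w (l, α)) α x + G2 q (co w) α x) + ∑ β, co w (0, β))
      + (-1 : ℂ) * Ψ α x := c1.add c2
  have key : ∀ k, hat (fun x => ((-1 : ℂ) * (G1 b a (fun l => co w (l, α)) α x + G2 q (co w) α x) + ∑ β, co w (0, β))
      + (-1 : ℂ) * Ψ α x) k = 0 := by
    intro k
    rw [hat_add c1 c2, hat_const_mul]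
    have s1 := Lk_hat hb ha hq hc k α
    have s2 := (hw (k, α)).mul_left ((((jb k ^ (2*d)) : ℝ) : ℂ)⁻¹)
    have hj : (((jb k ^ (2*d)) : ℝ) : ℂ) ≠ 0 := by
      have := jb_pos k
      exact_mod_cast (by positivity : jb k ^ (2*d) ≠ 0)
    have e2 : (((jb k ^ (2*d)) : ℝ) : ℂ)⁻¹ * ((((jb k ^ (2*d)) : ℝ) : ℂ) * hat (Ψ α) k) = hat (Ψ α) k :=
      inv_mul_cancel_left₀ hj _
    have s3 := s1.unique (s2.congr_fun (fun r => by
      unfold KSk co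
      field_simp))
    simp only at s3
    rw [s3, e2]; ring
  have hper : PerE fun x => ((-1 : ℂ) * (G1 b a (fun l => co w (l, α)) α x + G2 q (co w) α x) + ∑ β, co w (0, β))
      + (-1 : ℂ) * Ψ α x := by
    intro x ν
    have h1 := G1_per hbp hap (fun l => co w (l, α)) α x ν
    have h2 := G2_per hqp (co w) α x ν
    have h3 := hΨp α x ν
    simp only [h1, h2, h3]
  have := hat_unique _ c3 hper key x
  linear_combination -this

end

lemma tInt_const {d : ℕ} (c : ℝ) : tInt (fun _ : Fin d → ℝ => c) = c := by
  have := cube_vol d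
  unfold tInt
  rw [setIntegral_const]
  unfold cube at this
  rw [this, one_smul]

lemma tInt_re_FS {d : ℕ} {c : (Fin d → ℤ) → ℂ} (hc : WS 2 c) : tInt (fun x => (FS c x).re) = (c 0).re := by
  have h := hat_FS hc.zero_summable 0
  have hi : Integrable (FS c) (volume.restrict (cube d)) := cube_integrable (FS_continuous hc.zero_summable)
  rw [← h]
  unfold hat
  simp only [neg_zero, ee_zero, mul_one]
  exact integral_re hi

lemma gen_sub {d m : ℕ} {b : (Fin d → ℝ) → Fin m → Fin d → ℝ}
    {a : (Fin d → ℝ) → Fin m → Matrix (Fin d) (Fin d) ℝ} {q : Fin m → Fin m → (Fin d → ℝ) → ℝ}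
    {u v : (Fin d → ℝ) → Fin m → ℝ} (hu : ∀ α, ContDiff ℝ 2 fun x => u x α) (hv : ∀ α, ContDiff ℝ 2 fun x => v x α)
    (x : Fin d → ℝ) (α : Fin m) :
    gen b a q (fun x α => u x α - v x α) x α = gen b a q u x α - gen b a q v x α := by
  have pds : ∀ {f g : (Fin d → ℝ) → ℝ}, Differentiable ℝ f → Differentiable ℝ g → ∀ j x,
      pd (fun y => f y - g y) j x = pd f j x - pd g j x := by
    intro f g hf hg j x
    unfold pd
    rw [fderiv_fun_sub (hf x) (hg x)]; rfl
  have h1 : ∀ j x, pd (fun y => u y α - v y α) j x = pd (fun y => u y α) j x - pd (fun y => v y α) j x :=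
    pds ((hu α).differentiable (by norm_num)) ((hv α).differentiable (by norm_num))
  have h2 : ∀ i j x, pd2 (fun y => u y α - v y α) i j x = pd2 (fun y => u y α) i j x - pd2 (fun y => v y α) i j x := by
    intro i j x
    unfold pd2
    simp only [h1]
    exact pds ((pd_C1 (hu α) i).differentiable (by norm_num)) ((pd_C1 (hv α) i).differentiable (by norm_num)) j x
  unfold gen jumpOp
  simp only [h1, h2, mul_sub, Finset.sum_sub_distrib]
  ring

lemma HS_of_decay {d m : ℕ} (h : Fin m → (Fin d → ℝ) → ℂ)
    (hh : ∀ i, ContDiff ℝ (⊤ : ℕ∞) (h i)) (hp : ∀ i, PerE (h i)) :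
    ∃ f : HS ((Fin d → ℤ) × Fin m), ∀ p, f p = ((jb p.1 ^ (2*d) : ℝ) : ℂ) * hat (h p.2) p.1 := by
  obtain ⟨C, hC, hb⟩ := decay_unif h hh hp (2*d + 2*d)
  have hm : Memℓp (fun p : (Fin d → ℤ) × Fin m => ((jb p.1 ^ (2*d) : ℝ) : ℂ) * hat (h p.2) p.1) 2 := by
    apply memℓp_gen
    have hs := (Summable_fst (m := m) (summable_jb d)).mul_left (C^2)
    refine Summable.of_nonneg_of_le (fun p => by positivity) (fun p => ?_) hs
    have hj := jb_pos p.1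
    have h1 : ‖((jb p.1 ^ (2*d) : ℝ) : ℂ) * hat (h p.2) p.1‖ ≤ C * (jb p.1 ^ (2*d))⁻¹ := by
      rw [norm_mul, Complex.norm_real, Real.norm_of_nonneg (by positivity)]
      calc jb p.1 ^ (2*d) * ‖hat (h p.2) p.1‖ ≤ jb p.1 ^ (2*d) * (C * (jb p.1 ^ (2*d+2*d))⁻¹) :=
            mul_le_mul_of_nonneg_left (hb _ _) (by positivity)
        _ = C * (jb p.1 ^ (2*d))⁻¹ := by rw [pow_add]; field_simp
    have h3 : (jb p.1 ^ (2*d))⁻¹ ≤ 1 := inv_le_one_of_one_le₀ (one_le_pow₀ (jb_one_le _))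
    have h4 : 0 < (jb p.1 ^ (2*d))⁻¹ := by positivity
    have e : (2 : ENNReal).toReal = ((2 : ℕ) : ℝ) := by norm_num
    rw [e, Real.rpow_natCast]
    calc _ ≤ (C * (jb p.1 ^ (2*d))⁻¹) ^ 2 := pow_le_pow_left₀ (norm_nonneg _) h1 2
      _ = C^2 * ((jb p.1 ^ (2*d))⁻¹ * (jb p.1 ^ (2*d))⁻¹) := by ring
      _ ≤ C^2 * (jb p.1 ^ (2*d))⁻¹ := by
        apply mul_le_mul_of_nonneg_left _ (by positivity)
        exact mul_le_of_le_one_left h4.le h3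
  exact ⟨⟨_, hm⟩, fun p => rfl⟩

/-- solvability of the cell problem. With `b̄_k = ∑_α ∫ b_k(x,α) m(x,α) dx`,
for each `k` there is a unique `C²`, `1`-periodic, mean-zero `Φ_k` with
`ℒΦ_k(x,α) = b_k(x,α) - b̄_k`. -/
theorem cell_problem_solvable
    {d r m : ℕ} (hd : 0 < d) (hr : 0 < r) (hm : 0 < m)
    (b : (Fin d → ℝ) → Fin m → Fin d → ℝ)
    (σ : (Fin d → ℝ) → Fin m → Matrix (Fin d) (Fin r) ℝ)
    (q : Fin m → Fin m → (Fin d → ℝ) → ℝ)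
    (amin qbar : ℝ) (hamin : 0 < amin)
    (hb : ∀ α j, ContDiff ℝ (⊤ : ℕ∞) fun x => b x α j)
    (hσ : ∀ α i j, ContDiff ℝ (⊤ : ℕ∞) fun x => σ x α i j)
    (hell : ∀ (x ξ : Fin d → ℝ) (α : Fin m),
      amin * ∑ i, ξ i ^ 2 ≤ ξ ⬝ᵥ (diffMat σ x α *ᵥ ξ))
    (hq_smooth : ∀ α β, α ≠ β → ContDiff ℝ (⊤ : ℕ∞) (q α β))
    (hq_nonneg : ∀ α β, α ≠ β → ∀ x, 0 ≤ q α β x)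
    (hq_bdd : ∀ α β, α ≠ β → ∀ x, q α β x ≤ qbar)
    (hq_diag : ∀ α x, q α α x = -∑ β ∈ Finset.univ.filter (fun β => β ≠ α), q α β x)
    (hq_irred : ∀ (x : Fin d → ℝ) (B : Set (Fin m)), B.Nonempty → Bᶜ.Nonempty →
      ∃ α ∈ B, ∃ β ∈ Bᶜ, q α β x ≠ 0)
    (hb_per : ∀ α j, Per fun x => b x α j)
    (hσ_per : ∀ α i j, Per fun x => σ x α i j)
    (hq_per : ∀ α β, Per (q α β))
    (M : (Fin d → ℝ) → Fin m → ℝ)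
    (hM_nonneg : ∀ x α, 0 ≤ M x α)
    (hM_C2 : ∀ α, ContDiff ℝ 2 fun x => M x α)
    (hM_per : ∀ α, Per fun x => M x α)
    (hM_inv : ∀ x α, genAdj b (diffMat σ) q M x α = 0)
    (hM_norm : (∑ α, tInt fun x => M x α) = 1)
 :
    ∀ k : Fin d, ∃! Φk : (Fin d → ℝ) → Fin m → ℝ,
      (∀ α, ContDiff ℝ 2 fun x => Φk x α) ∧
      (∀ x α, gen b (diffMat σ) q Φk x α
        = b x α k - ∑ α', tInt fun x' => b x' α' k * M x' α') ∧
      (∀ α, Per fun x => Φk x α) ∧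
      (∑ α, tInt fun x => Φk x α) = 0 := by
  have : NeZero m := ⟨hm.ne'⟩
  have eA : ∀ α i j, (fun x => diffMat σ x α i j) = fun x => ∑ l, σ x α i l * σ x α j l := by
    intro α i j
    funext x
    simp [diffMat, Matrix.mul_apply]
  have haS : ∀ α i j, ContDiff ℝ (⊤ : ℕ∞) fun x => diffMat σ x α i j := by
    intro α i j
    rw [eA]
    exact ContDiff.sum fun l _ => (hσ α i l).mul (hσ α j l)
  have hap : ∀ α i j, Per fun x => diffMat σ x α i j := by
    intro α i j
    rw [eA]
    intro x ν
    have h1 : ∀ i l, σ (x + fun i => (ν i : ℝ)) α i l = σ x α i l := fun i l => hσ_per α i l x ν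
    simp only [h1]
  have hsym : ∀ x α i j, diffMat σ x α i j = diffMat σ x α j i := by
    intro x α i j
    have h1 := congrFun (eA α i j) x
    have h2 := congrFun (eA α j i) x
    refine h1.trans (Eq.trans ?_ h2.symm)
    exact Finset.sum_congr rfl fun l _ => mul_comm _ _
  have hqS : ∀ α β, ContDiff ℝ (⊤ : ℕ∞) (q α β) := by
    intro α β
    by_cases h : α = β
    · subst h
      have e : q α α = fun x => -∑ β ∈ Finset.univ.filter (fun β => β ≠ α), q α β x := funext (hq_diag α)
      rw [e]
      refine ContDiff.neg (ContDiff.sum fun β hβ => hq_smooth α β ?_)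
      exact fun h => (Finset.mem_filter.1 hβ).2 h.symm
    · exact hq_smooth α β h
  have hbc : ∀ α j, Continuous fun x => b x α j := fun α j => (hb α j).continuous
  have hac : ∀ α i j, Continuous fun x => diffMat σ x α i j := fun α i j => (haS α i j).continuous
  have hqc : ∀ α β, Continuous (q α β) := fun α β => (hqS α β).continuous
  have hMc : ∀ α, Continuous fun x => M x α := fun α => (hM_C2 α).continuous
  have h2t : (2 : WithTop ℕ∞) ≤ ((⊤ : ℕ∞) : WithTop ℕ∞) := by
    exact WithTop.coe_le_coe.2 (le_top : (2 : ℕ∞) ≤ ⊤)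
  have cplx : ∀ f : (Fin d → ℝ) → ℝ, ContDiff ℝ (⊤ : ℕ∞) f → ContDiff ℝ (⊤ : ℕ∞) fun x => (f x : ℂ) :=
    fun f hf => Complex.ofRealCLM.contDiff.comp hf
  have cplxp : ∀ f : (Fin d → ℝ) → ℝ, Per f → PerE fun x => (f x : ℂ) := by
    intro f hf x ν
    have := hf x ν
    simp only [this]
  have hpair : ∀ u : (Fin d → ℝ) → Fin m → ℝ, (∀ α, ContDiff ℝ 2 fun x => u x α) → (∀ α, Per fun x => u x α) →
      ∑ α, tInt (fun x => M x α * gen b (diffMat σ) q u x α) = 0 := fun u hu hup =>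
    pairing (fun α j => (hb α j).of_le h2t) (fun α i j => (haS α i j).of_le h2t) (fun α β _ => hqc α β)
      hq_diag hb_per hap hsym hM_C2 hM_per hM_inv hu hup
  have hsm : ∀ u : (Fin d → ℝ) → Fin m → ℝ, (∀ α, ContDiff ℝ 2 fun x => u x α) → (∀ α, Per fun x => u x α) →
      (∀ x α, gen b (diffMat σ) q u x α = 0) → ∃ c, ∀ x α, u x α = c := fun u hu hup hg =>
    strong_max hm b σ q amin qbar hamin hbc hac hell hq_nonneg hq_bdd hq_irred hb_per hap u hu hup hg
  -- properties of Fourier series with coefficients `co w`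
  have hc : ∀ (w : HS ((Fin d → ℤ) × Fin m)) β, WS 2 fun l => co w (l, β) := fun w β => WS_of_HS w β
  have hu2 : ∀ (w : HS ((Fin d → ℤ) × Fin m)) (φ : ℂ →L[ℝ] ℝ) α,
      ContDiff ℝ 2 fun x => φ (FS (fun l => co w (l, α)) x) := fun w φ α =>
    φ.contDiff.comp (FS_contDiff 2 (hc w α))
  have hup : ∀ (w : HS ((Fin d → ℤ) × Fin m)) (φ : ℂ →L[ℝ] ℝ) α,
      Per fun x => φ (FS (fun l => co w (l, α)) x) := by
    intro w φ α x ν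
    have := FS_per (fun l => co w (l, α)) x ν
    simp only [this]
  -- solvability in Fourier space
  have hsolve : ∀ Ψ : Fin m → (Fin d → ℝ) → ℂ, (∀ α, ContDiff ℝ (⊤ : ℕ∞) (Ψ α)) → (∀ α, PerE (Ψ α)) →
      ∃ w : HS ((Fin d → ℤ) × Fin m), ∀ α x, G1 b (diffMat σ) (fun l => co w (l, α)) α x + G2 q (co w) α x
        = (∑ β, co w (0, β)) - Ψ α x := by
    intro Ψ hΨ hΨp
    obtain ⟨f, hf⟩ := HS_of_decay Ψ hΨ hΨp
    obtain ⟨C1, hC1, hd1⟩ := decay_unif (fun p : Fin m × Fin d => fun x => (b x p.1 p.2 : ℂ))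
      (fun p => cplx _ (hb _ _)) (fun p => cplxp _ (hb_per _ _)) (2*d+1+2*d)
    obtain ⟨C2, hC2, hd2⟩ := decay_unif (fun p : Fin m × Fin d × Fin d => fun x => (diffMat σ x p.1 p.2.1 p.2.2 : ℂ))
      (fun p => cplx _ (haS _ _ _)) (fun p => cplxp _ (hap _ _ _)) (2*d+1+2*d)
    obtain ⟨C3, hC3, hd3⟩ := decay_unif (fun p : Fin m × Fin m => fun x => (q p.1 p.2 x : ℂ))
      (fun p => cplx _ (hqS _ _)) (fun p => cplxp _ (hq_per _ _)) (2*d+1+2*d)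
    have hC0 : 0 ≤ C1 + C2 + C3 := by positivity
    have up : ∀ (C : ℝ) (k : Fin d → ℤ), C ≤ C1 + C2 + C3 →
        C * (jb k ^ (2*d+1+2*d))⁻¹ ≤ (C1 + C2 + C3) * (jb k ^ (2*d+1+2*d))⁻¹ := by
      intro C k h
      have := jb_pos k
      exact mul_le_mul_of_nonneg_right h (by positivity)
    have hbh : ∀ α j k, ‖hat (fun x => (b x α j : ℂ)) k‖ ≤ (C1 + C2 + C3) * (jb k ^ (2*d+1+2*d))⁻¹ :=
      fun α j k => (hd1 (α, j) k).trans (up _ k (by linarith))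
    have hah : ∀ α i j k, ‖hat (fun x => (diffMat σ x α i j : ℂ)) k‖ ≤ (C1 + C2 + C3) * (jb k ^ (2*d+1+2*d))⁻¹ :=
      fun α i j k => (hd2 (α, i, j) k).trans (up _ k (by linarith))
    have hqh : ∀ α β k, ‖hat (fun x => (q α β x : ℂ)) k‖ ≤ (C1 + C2 + C3) * (jb k ^ (2*d+1+2*d))⁻¹ :=
      fun α β k => (hd3 (α, β) k).trans (up _ k (by linarith))
    have hcp : 0 < 2 * Real.pi ^ 2 * amin := by have := Real.pi_pos; positivity
    set bh : Fin m → Fin d → (Fin d → ℤ) → ℂ := fun α j => hat (fun x => (b x α j : ℂ)) with hbh_def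
    set ah : Fin m → Fin d → Fin d → (Fin d → ℤ) → ℂ := fun α i j => hat (fun x => (diffMat σ x α i j : ℂ))
      with hah_def
    set qh : Fin m → Fin m → (Fin d → ℤ) → ℂ := fun α β => hat (fun x => (q α β x : ℂ)) with hqh_def
    have bA := KA_bound ah (C1+C2+C3) _ hcp.le (2*d) hC0 hah
    have bC := KC_bound bh ah qh (C1+C2+C3) _ hcp.le (2*d) hC0 hah hbh hqh
    set cA : ℝ := 2 * Real.pi^2 * (d * (d * (C1+C2+C3))) + 2 * (2 * Real.pi ^ 2 * amin) with hcA
    obtain ⟨cC, hcC⟩ : ∃ cC : ℝ, cC = (d * (2 * Real.pi * (C1+C2+C3)) + 2 * Real.pi^2 * (d * (d * ((((2*d : ℕ) : ℝ)+2)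
      * (C1+C2+C3)))) + 2 * (2 * Real.pi ^ 2 * amin) + (C1+C2+C3) + 1) := ⟨_, rfl⟩
    rw [← hcC] at bC
    have hcA0 : 0 ≤ cA := by rw [hcA]; have := Real.pi_pos; positivity
    have hcC0 : 0 ≤ cC := by rw [hcC]; have := Real.pi_pos; positivity
    have hsum : ∀ p r, KAk ah (2 * Real.pi ^ 2 * amin) p r + (KSk bh ah qh (2*d) p r - KAk ah (2 * Real.pi ^ 2 * amin) p r)
        = KSk bh ah qh (2*d) p r := fun p r => by ring
    obtain ⟨w, hw⟩ := abstract_solve (J := (Fin d → ℤ) × Fin m)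
      (KAk ah (2 * Real.pi ^ 2 * amin))
      (fun p r => KSk bh ah qh (2*d) p r - KAk ah (2 * Real.pi ^ 2 * amin) p r)
      (fun p r => (KSk bh ah qh (2*d) p r - KAk ah (2 * Real.pi ^ 2 * amin) p r) * ((jb r.1 : ℝ) : ℂ))
      (fun p => (cA + cC) * (jb p.1 ^ (2*d))⁻¹)
      ((Summable_fst (m := m) (summable_jb d)).mul_left _)
      (fun p => (((jb p.1)⁻¹ : ℝ) : ℂ)) (phi_tendsto hd)
      (fun p r => (bA p r).trans (by
        have := jb_pos (p.1 - r.1)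
        exact mul_le_mul_of_nonneg_right (by linarith) (by positivity)))
      (fun p r => (bC p r).trans (by
        have := jb_pos (p.1 - r.1)
        exact mul_le_mul_of_nonneg_right (by linarith) (by positivity)))
      (fun p r => by
        have h0 : ((jb r.1 : ℝ) : ℂ) ≠ 0 := by exact_mod_cast (jb_pos r.1).ne'
        push_cast
        exact (mul_inv_cancel_right₀ h0 _).symm)
      (2 * Real.pi ^ 2 * amin) hcp (coer_KA (diffMat σ) hac hamin hell)
      (by
        intro w hw
        simp only [hsum] at hw
        have hs := fourier_solve hbc hac hqc hb_per hap hq_per (fun _ _ => (0:ℂ)) (fun _ => continuous_const)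
          (fun _ _ _ => rfl) w (fun p => by
            have := hw p
            rw [hat_const]
            simpa using this)
        have hφ : ∀ φ : ℂ →L[ℝ] ℝ, ∃ κ : ℝ, ∀ x α, φ (FS (fun l => co w (l, α)) x) = κ := by
          intro φ
          have hg : ∀ x α, gen b (diffMat σ) q (fun x α => φ (FS (fun l => co w (l, α)) x)) x α
              = φ (∑ β, co w (0, β)) := by
            intro x α
            rw [gen_FS hq_diag (hc w) φ x α, hs α x, sub_zero]
          have hz := hpair _ (hu2 w φ) (hup w φ)
          simp only [hg, mul_comm (M _ _), tInt_const_mul] at hz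
          rw [← Finset.mul_sum, hM_norm, mul_one] at hz
          refine hsm _ (hu2 w φ) (hup w φ) ?_
          intro x α
          rw [hg, hz]
        obtain ⟨κ1, h1⟩ := hφ Complex.reCLM
        obtain ⟨κ2, h2⟩ := hφ Complex.imCLM
        have hconst : ∀ α, FS (fun l => co w (l, α)) = fun _ => (⟨κ1, κ2⟩ : ℂ) := by
          intro α
          funext x
          exact Complex.ext (h1 x α) (h2 x α)
        have hcoef : ∀ l α, co w (l, α) = if l = 0 then (⟨κ1, κ2⟩ : ℂ) else 0 := by
          intro l α
          have := hat_FS (hc w α).zero_summable l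
          rw [hconst, hat_const] at this
          exact this.symm
        have hl : ∑ β, co w (0, β) = 0 := by
          have hre : ∀ φ : ℂ →L[ℝ] ℝ, φ (∑ β, co w (0, β)) = 0 := by
            intro φ
            have hg : ∀ x α, gen b (diffMat σ) q (fun x α => φ (FS (fun l => co w (l, α)) x)) x α
                = φ (∑ β, co w (0, β)) := by
              intro x α
              rw [gen_FS hq_diag (hc w) φ x α, hs α x, sub_zero]
            have hz := hpair _ (hu2 w φ) (hup w φ)
            simp only [hg, mul_comm (M _ _), tInt_const_mul] at hz
            rw [← Finset.mul_sum, hM_norm, mul_one] at hz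
            exact hz
          exact Complex.ext (hre Complex.reCLM) (hre Complex.imCLM)
        have hK : (⟨κ1, κ2⟩ : ℂ) = 0 := by
          simp only [hcoef, if_true, Finset.sum_const, Finset.card_univ, Fintype.card_fin, nsmul_eq_mul] at hl
          rcases mul_eq_zero.1 hl with h | h
          · exact absurd (by exact_mod_cast h) hm.ne'
          · exact h
        ext p
        have hp := hcoef p.1 p.2
        rw [hK, ite_self] at hp
        unfold co at hp
        rcases mul_eq_zero.1 hp with h | h
        · have hj := jb_pos p.1
          exact absurd (Complex.ofReal_eq_zero.1 h) (by positivity)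
        · exact h)
      f
    simp only [hsum, hf] at hw
    exact ⟨w, fun α x => fourier_solve hbc hac hqc hb_per hap hq_per Ψ (fun α => (hΨ α).continuous) hΨp w hw α x⟩
  intro k
  obtain ⟨B, hB⟩ : ∃ B, B = ∑ α', tInt fun x' => b x' α' k * M x' α' := ⟨_, rfl⟩
  rw [← hB]
  obtain ⟨w, hw⟩ := hsolve (fun α x => ((-(b x α k - B) : ℝ) : ℂ))
    (fun α => cplx _ ((hb α k).sub contDiff_const).neg)
    (fun α => cplxp _ (fun x ν => by
      have := hb_per α k x ν
      simp only at this
      simp only [this]))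
  have hg : ∀ x α, gen b (diffMat σ) q (fun x α => Complex.reCLM (FS (fun l => co w (l, α)) x)) x α
      = (∑ β, co w (0, β)).re + (b x α k - B) := by
    intro x α
    rw [gen_FS hq_diag (hc w) _ x α, hw α x]
    simp only [Complex.reCLM_apply, Complex.sub_re, Complex.ofReal_re]
    ring
  have hl : (∑ β, co w (0, β)).re = 0 := by
    have hz := hpair _ (hu2 w Complex.reCLM) (hup w Complex.reCLM)
    simp only [hg] at hz
    obtain ⟨ℓ, hℓ⟩ : ∃ ℓ, ℓ = (∑ β, co w (0, β)).re := ⟨_, rfl⟩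
    rw [← hℓ] at hz ⊢
    have e : ∀ α, tInt (fun x => M x α * (ℓ + (b x α k - B)))
        = (ℓ - B) * tInt (fun x => M x α) + tInt (fun x => b x α k * M x α) := by
      intro α
      have k1 : Continuous fun x => (ℓ - B) * M x α := continuous_const.mul (hMc α)
      have k2 : Continuous fun x => b x α k * M x α := (hbc α k).mul (hMc α)
      rw [← tInt_const_mul, ← tInt_cont_add k1 k2]
      congr 1
      funext x
      ring
    simp only [e, Finset.sum_add_distrib] at hz
    rw [← Finset.mul_sum, hM_norm, ← hB] at hz
    linarith
  refine ⟨fun x α => Complex.reCLM (FS (fun l => co w (l, α)) x), ⟨hu2 w _, ?_, hup w _, ?_⟩, ?_⟩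
  · intro x α
    rw [hg, hl, zero_add]
  · have e : ∀ α, tInt (fun x => Complex.reCLM (FS (fun l => co w (l, α)) x)) = (co w (0, α)).re := fun α =>
      tInt_re_FS (hc w α)
    simp only [e]
    rw [← Complex.re_sum]
    exact hl
  · rintro v ⟨hv2, hvg, hvp, hv0⟩
    have hz0 : ∑ α, tInt (fun x => Complex.reCLM (FS (fun l => co w (l, α)) x)) = 0 := by
      have e : ∀ α, tInt (fun x => Complex.reCLM (FS (fun l => co w (l, α)) x)) = (co w (0, α)).re := fun α =>
        tInt_re_FS (hc w α)
      simp only [e]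
      rw [← Complex.re_sum]
      exact hl
    obtain ⟨κ, hκ⟩ := hsm (fun x α => v x α - Complex.reCLM (FS (fun l => co w (l, α)) x))
      (fun α => (hv2 α).sub (hu2 w _ α))
      (fun α x ν => by
        have h1 := hvp α x ν
        have h2 := hup w Complex.reCLM α x ν
        simp only at h1 h2
        simp only [h1, h2])
      (fun x α => by
        rw [gen_sub hv2 (hu2 w Complex.reCLM), hvg, hg, hl]
        ring)
    have hve : ∀ α, tInt (fun x => v x α) = tInt (fun x => Complex.reCLM (FS (fun l => co w (l, α)) x)) + κ := by
      intro α
      rw [← tInt_const (d := d) κ, ← tInt_cont_add (hu2 w Complex.reCLM α).continuous continuous_const]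
      congr 1
      funext x
      have := hκ x α
      linarith
    simp only [hve, Finset.sum_add_distrib] at hv0
    rw [hz0, zero_add, Finset.sum_const, Finset.card_univ, Fintype.card_fin, nsmul_eq_mul] at hv0
    have hκ0 : κ = 0 := by
      rcases mul_eq_zero.1 hv0 with h | h
      · exact absurd (by exact_mod_cast h) hm.ne'
      · exact h
    funext x α
    have := hκ x α
    rw [hκ0] at this
    linarith
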